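/- For every integer m ≥ 4, the generalized Simons cone S_m = {(x,y) ∈ ℝ^m × ℝ^m : |x| = |y|} is an Almgren minimal set of dimension 2m−1 in ℝ^{2m}. (Derived in the paper from Theorem 2.10 2°, Proposition 5.1, and Example 5.2.) -/

import Mathlib

open Set MeasureTheory Metric NNReal

noncomputable section

/-- A deformation in an open set `U ⊆ ℝ^N`. -/
def IsDeformation {N : ℕ} (U : Set (EuclideanSpace ℝ (Fin N)))
    (φ : ℝ → EuclideanSpace ℝ (Fin N) → EuclideanSpace ℝ (Fin N)) : Prop :=
  (∀ t ∈ Icc (0:ℝ) 1, MapsTo (φ t) (closure U) (closure U)) ∧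
  (∀ x ∈ closure U, φ 0 x = x) ∧
  ContinuousOn (fun p : ℝ × EuclideanSpace ℝ (Fin N) => φ p.1 p.2)
    (Icc (0:ℝ) 1 ×ˢ closure U) ∧
  (∃ K : ℝ≥0, LipschitzOnWith K (φ 1) (closure U)) ∧
  (closure (⋃ t ∈ Icc (0:ℝ) 1,
      ({x ∈ closure U | φ t x ≠ x} ∪ φ t '' {x ∈ closure U | φ t x ≠ x})) ⊆ U ∧
    IsCompact (closure (⋃ t ∈ Icc (0:ℝ) 1,
      ({x ∈ closure U | φ t x ≠ x} ∪ φ t '' {x ∈ closure U | φ t x ≠ x}))))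

/-- `E` is an Almgren minimal set of dimension `d` in the open set `U`. -/
def AlmgrenMinimal {N : ℕ} (d : ℝ) (U E : Set (EuclideanSpace ℝ (Fin N))) : Prop :=
  IsClosed E ∧ E ⊆ closure U ∧
  (∀ (x : EuclideanSpace ℝ (Fin N)) (r : ℝ), closedBall x r ⊆ U →
      μH[d] (E ∩ closedBall x r) < ⊤) ∧
  ∀ φ, IsDeformation U φ →
    μH[d] (E \ (φ 1 '' E)) ≤ μH[d] ((φ 1 '' E) \ E)

/-- Sum of squares of the coordinates with index in `[a, b)`. -/
def sumSq {n : ℕ} (z : EuclideanSpace ℝ (Fin n)) (a b : ℕ) : ℝ :=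
  ∑ i : Fin n, if a ≤ (i : ℕ) ∧ (i : ℕ) < b then z i ^ 2 else 0

end

/-- On an interval free of `S`, membership in a set which is locally constant off `S` is constant. -/
lemma mem_iff_mem_of_isPreconnected {X : Type*} [TopologicalSpace X] {S U I : Set X}
    (hU : ∀ t ∉ S, ∀ᶠ t' in nhds t, (t' ∈ U ↔ t ∈ U)) (hI : IsPreconnected I)
    (hIS : Disjoint I S) {a b : X} (ha : a ∈ I) (hb : b ∈ I) : a ∈ U ↔ b ∈ U := by
  classical
  have hcont : ContinuousOn (fun t => decide (t ∈ U)) I := by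
    intro t ht
    refine ContinuousAt.continuousWithinAt ?_
    have h := hU t (disjoint_left.1 hIS ht)
    refine continuousAt_const.congr (f := fun _ => decide (t ∈ U)) ?_
    filter_upwards [h] with t' ht'
    simp [ht']
  have := hI.constant hcont ha hb
  simpa using this

/-- One-dimensional slicing estimate: the integral of `g'` over a set `U` whose indicator is locally
constant off `S` is controlled by the values of `g` near `S`. -/
lemma abs_setIntegral_deriv_le {S U : Set ℝ} (hUm : MeasurableSet U)
    (hU : ∀ t ∉ S, ∀ᶠ t' in nhds t, (t' ∈ U ↔ t ∈ U))
    {g : ℝ → ℝ} (hg : ContDiff ℝ 1 g) {C T r : ℝ} (hC : ∀ t, |deriv g t| ≤ C)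
    (hr : 0 ≤ r) (N : ℕ) (hN : N * r = 2 * T) (hT : ∀ t, T ≤ |t| → g t = 0) (hT0 : 0 < T)
    (bad : ℕ → Prop) [DecidablePred bad]
    (hbad : ∀ k : ℕ, (Ico (-T + k * r) (-T + (k + 1) * r) ∩ S).Nonempty → bad k) :
    |∫ t in U, deriv g t| ≤
      ∑ k ∈ Finset.range N, if bad k then |g (-T + k * r)| + C * r else 0 := by
  classical
  set τ : ℕ → ℝ := fun k => -T + k * r with hτ
  have hτs : ∀ k, τ (k + 1) = τ k + r := fun k => by simp [hτ]; ring
  set h : ℝ → ℝ := fun t => U.indicator 1 t - 1 / 2 with hh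
  have hhv : ∀ t, |h t| ≤ 1 / 2 := by
    intro t
    by_cases ht : t ∈ U <;> simp [hh, ht] <;> norm_num [abs_le]
  have hder : Continuous (deriv g) := hg.continuous_deriv le_rfl
  have hdiff : ∀ t, DifferentiableAt ℝ g t := fun t => hg.differentiable one_ne_zero t
  have hftc : ∀ a b, ∫ t in a..b, deriv g t = g b - g a := fun a b =>
    intervalIntegral.integral_deriv_eq_sub (fun t _ => hdiff t) (hder.intervalIntegrable _ _)
  have hmeas : Measurable h := (measurable_one.indicator hUm).sub_const _
  have hint : ∀ a b, IntervalIntegrable (fun t => h t * deriv g t) volume a b := by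
    intro a b
    refine intervalIntegrable_iff.2 <|
      (intervalIntegrable_iff.1 (hder.intervalIntegrable a b)).bdd_mul (c := 1 / 2) hmeas.aestronglyMeasurable ?_
    exact Filter.Eventually.of_forall fun t => by simpa using hhv t
  have hsum : ∫ t in U, deriv g t =
      ∑ k ∈ Finset.range N, ∫ t in τ k..τ (k + 1), h t * deriv g t := by
    rw [intervalIntegral.sum_integral_adjacent_intervals (fun k _ => hint _ _)]
    have h0 : τ 0 = -T := by simp [hτ]
    have h1 : τ N = T := by simp [hτ, hN]; ring
    rw [h0, h1]
    have hz : ∀ t, t ∉ Ioc (-T) T → deriv g t = 0 := by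
      intro t ht
      have hTt : T ≤ |t| := by
        by_contra! hlt
        exact ht ⟨(abs_lt.1 hlt).1, (abs_lt.1 hlt).2.le⟩
      rcases hTt.lt_or_eq with hlt | heq
      · have : g =ᶠ[nhds t] fun _ => 0 := by
          filter_upwards [(isOpen_lt continuous_const continuous_abs).mem_nhds hlt] with s hs
          exact hT s (le_of_lt hs)
        rw [this.deriv_eq]; simp
      · -- boundary point: continuity of the derivative
        have htT : t = -T := by
          rcases abs_choice t with h' | h'
          · exfalso; apply ht; constructor <;> linarith
          · linarith
        have hc : ∀ s ∈ Iio (-T), deriv g s = 0 := by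
          intro s hs
          have hs' : T < |s| := by
            have := neg_le_abs s
            have := mem_Iio.1 hs
            linarith
          have : g =ᶠ[nhds s] fun _ => 0 := by
            filter_upwards [(isOpen_lt continuous_const continuous_abs).mem_nhds hs'] with u hu
            exact hT u (le_of_lt hu)
          rw [this.deriv_eq]; simp
        have hcl : closure (Iio (-T)) ⊆ {s | deriv g s = 0} :=
          closure_minimal hc (isClosed_eq hder continuous_const)
        rw [closure_Iio] at hcl
        exact hcl (by rw [htT]; exact mem_Iic.2 le_rfl)
    have e1 : ∫ t in U, deriv g t = ∫ t in (-T)..T, U.indicator 1 t * deriv g t := by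
      rw [intervalIntegral.integral_of_le (by linarith), ← integral_indicator hUm,
        ← integral_indicator measurableSet_Ioc]
      congr 1
      ext t
      by_cases h1 : t ∈ Ioc (-T) T
      · by_cases h2 : t ∈ U <;> simp [h1, h2, indicator_of_mem]
      · by_cases h2 : t ∈ U <;> simp [h1, h2, hz t h1]
    have e2 : ∫ t in (-T)..T, h t * deriv g t =
        (∫ t in (-T)..T, U.indicator 1 t * deriv g t) - (∫ t in (-T)..T, (1 / 2) * deriv g t) := by
      rw [← intervalIntegral.integral_sub]
      · congr 1; ext t; simp [hh]; ring
      · refine intervalIntegrable_iff.2 <| (intervalIntegrable_iff.1 (hder.intervalIntegrable _ _)).bdd_mul (c := 1)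
          (measurable_one.indicator hUm).aestronglyMeasurable ?_
        exact Filter.Eventually.of_forall fun t => by by_cases h2 : t ∈ U <;> simp [h2]
      · exact (hder.const_smul (1 / 2 : ℝ)).intervalIntegrable _ _
    rw [e1, e2, intervalIntegral.integral_const_mul, hftc, hT T (le_abs_self _),
      hT (-T) (by simp [le_abs_self])]
    simp
  have key : ∀ K : ℕ, ∃ σ : ℝ, |σ| ≤ 1 / 2 ∧ (τ K ∉ S → σ = h (τ K)) ∧
      |(∑ k ∈ Finset.range K, ∫ t in τ k..τ (k + 1), h t * deriv g t) - σ * g (τ K)| ≤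
        ∑ k ∈ Finset.range K, if bad k then |g (τ k)| + C * r else 0 := by
    intro K
    induction K with
    | zero =>
      refine ⟨h (τ 0), hhv _, fun _ => rfl, ?_⟩
      have h0 : τ 0 = -T := by simp [hτ]
      have : g (τ 0) = 0 := hT _ (by rw [h0, abs_neg]; exact le_abs_self T)
      simp [this]
    | succ K ih =>
      obtain ⟨σ, hσ, hσS, hle⟩ := ih
      rw [Finset.sum_range_succ, Finset.sum_range_succ]
      have hle' : τ K ≤ τ (K + 1) := by rw [hτs]; linarith
      have hI : |∫ t in τ K..τ (K + 1), h t * deriv g t| ≤ 1 / 2 * C * r := by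
        have := intervalIntegral.norm_integral_le_of_norm_le_const (a := τ K) (b := τ (K + 1))
          (f := fun t => h t * deriv g t) (C := 1 / 2 * C) (fun t _ => by
            rw [norm_mul]
            exact mul_le_mul (hhv t) (hC t) (norm_nonneg _) (by norm_num))
        rwa [hτs, add_sub_cancel_left, abs_of_nonneg hr, ← hτs] at this
      have hgd : |g (τ (K + 1))| ≤ |g (τ K)| + C * r := by
        have := intervalIntegral.norm_integral_le_of_norm_le_const (a := τ K) (b := τ (K + 1))
          (f := deriv g) (C := C) (fun t _ => hC t)
        rw [hftc, hτs, add_sub_cancel_left, abs_of_nonneg hr, ← hτs, Real.norm_eq_abs] at this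
        have h2 := abs_sub_abs_le_abs_sub (g (τ (K + 1))) (g (τ K))
        linarith
      by_cases hb : bad K
      · refine ⟨h (τ (K + 1)), hhv _, fun _ => rfl, ?_⟩
        rw [if_pos hb]
        set s' := ∑ k ∈ Finset.range K, ∫ t in τ k..τ (k + 1), h t * deriv g t
        set I' := ∫ t in τ K..τ (K + 1), h t * deriv g t
        have h1 : |σ * g (τ K)| ≤ 1 / 2 * |g (τ K)| := by
          rw [abs_mul]; exact mul_le_mul_of_nonneg_right hσ (abs_nonneg _)
        have h2 : |h (τ (K + 1)) * g (τ (K + 1))| ≤ 1 / 2 * |g (τ (K + 1))| := by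
          rw [abs_mul]; exact mul_le_mul_of_nonneg_right (hhv _) (abs_nonneg _)
        have e : s' + I' - h (τ (K + 1)) * g (τ (K + 1)) =
            (s' - σ * g (τ K)) + σ * g (τ K) + I' + -(h (τ (K + 1)) * g (τ (K + 1))) := by ring
        have h3 := abs_add_le ((s' - σ * g (τ K)) + σ * g (τ K) + I')
          (-(h (τ (K + 1)) * g (τ (K + 1))))
        have h4 := abs_add_le ((s' - σ * g (τ K)) + σ * g (τ K)) I'
        have h5 := abs_add_le (s' - σ * g (τ K)) (σ * g (τ K))
        rw [abs_neg] at h3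
        rw [e]
        linarith
      · have hdis : Disjoint (Ico (τ K) (τ (K + 1))) S := by
          rw [disjoint_iff_inter_eq_empty, ← not_nonempty_iff_eq_empty]
          intro hne
          exact hb (hbad K (by simpa [hτ] using hne))
        rcases hr.eq_or_lt with hr0 | hr0
        · have heq : τ (K + 1) = τ K := by rw [hτs, ← hr0, add_zero]
          refine ⟨σ, hσ, by rwa [heq], ?_⟩
          rw [heq, intervalIntegral.integral_same, if_neg hb]
          simpa using hle
        have hlt : τ K < τ (K + 1) := by rw [hτs]; linarith
        have hKS : τ K ∉ S := disjoint_left.1 hdis ⟨le_rfl, hlt⟩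
        have hconst : ∀ t ∈ Ico (τ K) (τ (K + 1)), h t = h (τ K) := by
          intro t ht
          have := mem_iff_mem_of_isPreconnected hU isPreconnected_Ico hdis ht ⟨le_rfl, hlt⟩
          by_cases h2 : t ∈ U
          · simp [hh, h2, this.1 h2]
          · simp [hh, h2, mt this.2 h2]
        have hIe : ∫ t in τ K..τ (K + 1), h t * deriv g t =
            h (τ K) * (g (τ (K + 1)) - g (τ K)) := by
          rw [← hftc, ← intervalIntegral.integral_const_mul]
          refine intervalIntegral.integral_congr_ae ?_
          have : ∀ᵐ t : ℝ, t ≠ τ (K + 1) := by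
            simp [ae_iff]
          filter_upwards [this] with t ht hm
          rw [uIoc_of_le hle'] at hm
          rw [hconst t ⟨hm.1.le, lt_of_le_of_ne hm.2 ht⟩]
        refine ⟨h (τ K), hhv _, ?_, ?_⟩
        · intro hS
          have hdis' : Disjoint (Icc (τ K) (τ (K + 1))) S := by
            rw [← Ico_insert_right hle', disjoint_insert_left]
            exact ⟨hS, hdis⟩
          have := mem_iff_mem_of_isPreconnected hU isPreconnected_Icc hdis'
            (left_mem_Icc.2 hle') (right_mem_Icc.2 hle')
          by_cases h2 : τ K ∈ U
          · simp [hh, h2, this.1 h2]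
          · simp [hh, h2, mt this.2 h2]
        · rw [hIe, if_neg hb, add_zero, ← hσS hKS]
          convert hle using 2
          ring
  obtain ⟨σ, -, -, hle⟩ := key N
  have hgN : g (τ N) = 0 := hT _ (by
    have : τ N = T := by simp [hτ, hN]; ring
    rw [this]; exact le_abs_self T)
  rw [hgN, mul_zero, sub_zero] at hle
  rwa [hsum]

/-- Orthonormal splitting of `ℝⁿ` along a unit vector `e`: coordinates `(y, t)` with `z = Q y + t e`. -/
structure UnitSplitting {n : ℕ} (d : ℕ) (e : EuclideanSpace ℝ (Fin n)) where
  P : EuclideanSpace ℝ (Fin n) →L[ℝ] EuclideanSpace ℝ (Fin d)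
  Q : EuclideanSpace ℝ (Fin d) →L[ℝ] EuclideanSpace ℝ (Fin n)
  norm_e : ‖e‖ = 1
  P_apply : ∀ y (t : ℝ), P (Q y + t • e) = y
  inner_apply : ∀ y (t : ℝ), inner ℝ (Q y + t • e) e = t
  recompose : ∀ z, Q (P z) + (inner ℝ z e : ℝ) • e = z
  norm_sq : ∀ z, ‖z‖ ^ 2 = ‖P z‖ ^ 2 + (inner ℝ z e : ℝ) ^ 2
  measurePreserving : MeasurePreserving
    (fun p : EuclideanSpace ℝ (Fin d) × ℝ => Q p.1 + p.2 • e) (volume.prod volume) volume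

lemma exists_unitSplitting {n d : ℕ} (hn : n = d + 1) (e : EuclideanSpace ℝ (Fin n))
    (he : ‖e‖ = 1) : Nonempty (UnitSplitting d e) := by
  have hcard : Module.finrank ℝ (EuclideanSpace ℝ (Fin n)) = Fintype.card (Fin (d + 1)) := by
    simp [hn]
  obtain ⟨b, hb⟩ := Orthonormal.exists_orthonormalBasis_extension_of_card_eq hcard
    (v := fun _ : Fin (d + 1) => e) (s := {0}) (by
      constructor
      · intro i; simpa using he
      · intro i j hij; exact absurd (Subsingleton.elim i j) hij)
  have hb0 : b 0 = e := hb 0 rfl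
  let P₀ : EuclideanSpace ℝ (Fin n) →ₗ[ℝ] EuclideanSpace ℝ (Fin d) :=
    { toFun := fun z => WithLp.toLp 2 fun i => b.repr z i.succ
      map_add' := fun x y => by ext i; simp
      map_smul' := fun c x => by ext i; simp }
  let J : EuclideanSpace ℝ (Fin d) →ₗ[ℝ] EuclideanSpace ℝ (Fin (d + 1)) :=
    { toFun := fun y => WithLp.toLp 2 (Fin.cons 0 fun i => y i)
      map_add' := fun x y => by
        ext i; refine Fin.cases ?_ (fun j => ?_) i <;> simp
      map_smul' := fun c x => by
        ext i; refine Fin.cases ?_ (fun j => ?_) i <;> simp }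
  let Q₀ : EuclideanSpace ℝ (Fin d) →ₗ[ℝ] EuclideanSpace ℝ (Fin n) :=
    b.repr.symm.toLinearMap ∘ₗ J
  have hbe : b.repr e = EuclideanSpace.single 0 1 := by rw [← hb0]; exact b.repr_self 0
  have hrep : ∀ y (t : ℝ), b.repr (Q₀ y + t • e) = WithLp.toLp 2 (Fin.cons t fun i => y i) := by
    intro y t
    have h1 : b.repr (Q₀ y) = J y := b.repr.apply_symm_apply _
    rw [map_add, map_smul, h1, hbe]
    ext i
    refine Fin.cases ?_ (fun j => ?_) i
    · simp [J]
    · simp [J]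
  have hinner : ∀ z, (inner ℝ z e : ℝ) = b.repr z 0 := by
    intro z; rw [b.repr_apply_apply, hb0, real_inner_comm]
  have hPa : ∀ y (t : ℝ), P₀ (Q₀ y + t • e) = y := by
    intro y t
    ext i
    have := congrArg (fun w => w i.succ) (hrep y t)
    simpa [P₀] using this
  have hIa : ∀ y (t : ℝ), (inner ℝ (Q₀ y + t • e) e : ℝ) = t := by
    intro y t
    rw [hinner, hrep]; simp
  have hmp : MeasurePreserving
      (fun p : EuclideanSpace ℝ (Fin d) × ℝ => Q₀ p.1 + p.2 • e) (volume.prod volume) volume := by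
    have m1 := (MeasurePreserving.id (volume : Measure ℝ)).prod
      (EuclideanSpace.volume_preserving_symm_measurableEquiv_toLp (Fin d))
    have m2 := (volume_preserving_piFinSuccAbove (fun _ : Fin (d + 1) => ℝ) 0).symm
    have m3 := EuclideanSpace.volume_preserving_symm_measurableEquiv_toLp (Fin (d + 1))
    have m4 := b.measurePreserving_repr_symm
    have m0 : MeasurePreserving (Prod.swap : EuclideanSpace ℝ (Fin d) × ℝ → _)
      (volume.prod volume) (volume.prod volume) := Measure.measurePreserving_swap
    have m5 : MeasurePreserving _ (volume.prod volume) volume := m2.comp (m1.comp m0)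
    have := m4.comp (m3.symm.comp m5)
    convert this using 1
    ext1 p
    simp only [Function.comp]
    apply b.repr.injective
    rw [hrep, b.repr.apply_symm_apply]
    ext i
    refine Fin.cases ?_ (fun j => ?_) i
    · simp
    · simp
  refine ⟨⟨LinearMap.toContinuousLinearMap P₀, LinearMap.toContinuousLinearMap Q₀, he,
    hPa, hIa, ?_, ?_, hmp⟩⟩
  · intro z
    apply b.repr.injective
    change b.repr (Q₀ (P₀ z) + _) = _
    rw [hrep, hinner]
    ext i
    refine Fin.cases ?_ (fun j => ?_) i <;> simp [P₀]
  · intro z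
    rw [hinner, ← b.repr.norm_map z, EuclideanSpace.norm_sq_eq, EuclideanSpace.norm_sq_eq,
      Fin.sum_univ_succ, add_comm]
    simp [P₀]

namespace UnitSplitting
variable {n d : ℕ} {e : EuclideanSpace ℝ (Fin n)} (s : UnitSplitting d e)
include s

lemma norm_P_le (z : EuclideanSpace ℝ (Fin n)) : ‖s.P z‖ ≤ ‖z‖ := by
  have := s.norm_sq z
  nlinarith [sq_nonneg (inner ℝ z e : ℝ), norm_nonneg z, norm_nonneg (s.P z)]

lemma lipschitz_P : LipschitzWith 1 s.P :=
  LipschitzWith.of_dist_le_mul fun x y => by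
    simpa [dist_eq_norm, ← map_sub] using s.norm_P_le (x - y)

end UnitSplitting

lemma euclideanHausdorffMeasure_image_le_of_lipschitzOnWith {X Y : Type*}
    [MetricSpace X] [MeasurableSpace X] [BorelSpace X]
    [MetricSpace Y] [MeasurableSpace Y] [BorelSpace Y] {K : ℝ≥0} {f : X → Y} {s : Set X}
    (h : LipschitzOnWith K f s) (d : ℕ) : μHE[d] (f '' s) ≤ (K : ENNReal) ^ d * μHE[d] s := by
  simp only [Measure.euclideanHausdorffMeasure_def, Measure.smul_apply, ENNReal.smul_def,
    smul_eq_mul]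
  have := h.hausdorffMeasure_image_le (d := d) (by positivity)
  rw [ENNReal.rpow_natCast] at this
  calc _ ≤ _ := mul_le_mul_right this _
    _ = _ := by ring

namespace UnitSplitting
variable {n d : ℕ} {e : EuclideanSpace ℝ (Fin n)} (s : UnitSplitting d e)
include s

lemma integral_eq {f : EuclideanSpace ℝ (Fin n) → ℝ} (hf : Integrable f) :
    ∫ z, f z = ∫ y, ∫ t : ℝ, f (s.Q y + t • e) := by
  have h1 : ∫ z, f z = ∫ p : EuclideanSpace ℝ (Fin d) × ℝ, f (s.Q p.1 + p.2 • e)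
      ∂(volume.prod volume) := by
    conv_lhs => rw [← s.measurePreserving.map_eq]
    rw [integral_map s.measurePreserving.measurable.aemeasurable]
    rw [s.measurePreserving.map_eq]
    exact hf.aestronglyMeasurable
  rw [h1, integral_prod]
  exact (s.measurePreserving.integrable_comp hf.aestronglyMeasurable).2 hf

lemma integrable_slice {f : EuclideanSpace ℝ (Fin n) → ℝ} (hf : Integrable f) :
    Integrable fun y => ∫ t : ℝ, f (s.Q y + t • e) := by
  have := (s.measurePreserving.integrable_comp hf.aestronglyMeasurable).2 hf
  exact this.integral_prod_left

lemma volume_restrict_image_le (B : Set (EuclideanSpace ℝ (Fin n))) :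
    (volume : Measure (EuclideanSpace ℝ (Fin d))).restrict (s.P '' B) ≤
      (μHE[d].restrict B).map s.P := by
  refine Measure.le_iff.2 fun T hT => ?_
  rw [Measure.restrict_apply hT, Measure.map_apply s.P.continuous.measurable hT,
    Measure.restrict_apply (s.P.continuous.measurable hT),
    ← EuclideanSpace.euclideanHausdorffMeasure_eq_volume]
  have h1 : T ∩ s.P '' B = s.P '' (s.P ⁻¹' T ∩ B) := by
    ext y; constructor
    · rintro ⟨hy, z, hz, rfl⟩; exact ⟨z, ⟨hy, hz⟩, rfl⟩
    · rintro ⟨z, ⟨h1, h2⟩, rfl⟩; exact ⟨h1, z, h2, rfl⟩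
  rw [h1]
  simpa using euclideanHausdorffMeasure_image_le_of_lipschitzOnWith
    (s.lipschitz_P.lipschitzOnWith (s := s.P ⁻¹' T ∩ B)) d

lemma deriv_slice {ψ : EuclideanSpace ℝ (Fin n) → ℝ} (hψ : ContDiff ℝ 1 ψ)
    (y : EuclideanSpace ℝ (Fin d)) (t : ℝ) :
    HasDerivAt (fun t : ℝ => ψ (s.Q y + t • e)) (fderiv ℝ ψ (s.Q y + t • e) e) t := by
  have h1 : HasDerivAt (fun t : ℝ => s.Q y + t • e) e t := by
    simpa using ((hasDerivAt_id t).smul_const e).const_add (s.Q y)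
  exact (hψ.differentiable one_ne_zero _).hasFDerivAt.comp_hasDerivAt t h1

omit s in
lemma integrable_fderiv_apply {ψ : EuclideanSpace ℝ (Fin n) → ℝ} (hψ : ContDiff ℝ 1 ψ)
    (hc : HasCompactSupport ψ) (v : EuclideanSpace ℝ (Fin n)) :
    Integrable fun z => fderiv ℝ ψ z v :=
  ((hψ.continuous_fderiv one_ne_zero).clm_apply continuous_const).integrable_of_hasCompactSupport
    (hc.fderiv_apply (𝕜 := ℝ) v)

/-- Discretized slicing estimate at scale `2T/N`. -/
lemma enorm_setIntegral_fderiv_le {F Ω : Set (EuclideanSpace ℝ (Fin n))}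
    (hF : MeasurableSet F) (hΩm : MeasurableSet Ω)
    (hΩ : ∀ z ∉ F, ∀ᶠ z' in nhds z, (z' ∈ Ω ↔ z ∈ Ω))
    {ψ : EuclideanSpace ℝ (Fin n) → ℝ} (hψ : ContDiff ℝ 1 ψ) (hc : HasCompactSupport ψ)
    {T C : ℝ} (hT0 : 0 < T) (hT : ∀ z, T ≤ ‖z‖ → ψ z = 0) (hC : ∀ z, ‖fderiv ℝ ψ z‖ ≤ C)
    {N : ℕ} (hN : 0 < N) :
    ‖∫ z in Ω, fderiv ℝ ψ z e‖ₑ ≤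
      ∫⁻ z in F ∩ closedBall 0 (2 * T), ENNReal.ofReal (|ψ z| + 2 * C * (2 * T / N))
        ∂μHE[d] := by
  classical
  set r : ℝ := 2 * T / N with hr
  have hN' : (0 : ℝ) < N := by exact_mod_cast hN
  have hr0 : 0 < r := by positivity
  have hNr : N * r = 2 * T := by rw [hr]; field_simp
  have hC0 : 0 ≤ C := (norm_nonneg _).trans (hC 0)
  set B : ℕ → Set (EuclideanSpace ℝ (Fin n)) := fun k =>
    {z | z ∈ F ∧ ‖s.P z‖ ≤ T ∧ (inner ℝ z e : ℝ) ∈ Ico (-T + k * r) (-T + (k + 1) * r)} with hB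
  set w : ℕ → EuclideanSpace ℝ (Fin d) → ENNReal := fun k y =>
    ENNReal.ofReal (|ψ (s.Q y + (-T + k * r) • e)| + C * r) with hw
  have hBm : ∀ k, MeasurableSet (B k) := by
    intro k
    refine hF.inter (MeasurableSet.inter ?_ ?_)
    · exact measurableSet_le s.P.continuous.norm.measurable measurable_const
    · have : Measurable fun z : EuclideanSpace ℝ (Fin n) => (inner ℝ z e : ℝ) :=
        (continuous_id.inner continuous_const).measurable
      exact this measurableSet_Ico
  have hwm : ∀ k, Measurable (w k) := by
    intro k
    have : Continuous fun y => |ψ (s.Q y + (-T + k * r) • e)| + C * r :=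
      ((hψ.continuous.comp (s.Q.continuous.add continuous_const)).abs).add continuous_const
    exact this.measurable.ennreal_ofReal
  have hint := integrable_fderiv_apply hψ hc e
  have hlip : ∀ z z', |ψ z - ψ z'| ≤ C * ‖z - z'‖ := by
    intro z z'
    exact Convex.norm_image_sub_le_of_norm_fderiv_le (𝕜 := ℝ) (s := univ)
      (fun x _ => hψ.differentiable one_ne_zero x) (fun x _ => hC x) convex_univ
      (mem_univ _) (mem_univ _)
  -- the estimate on each line
  have hline : ∀ y, ‖∫ t : ℝ, Ω.indicator (fun z => fderiv ℝ ψ z e) (s.Q y + t • e)‖ₑ ≤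
      ∑ k ∈ Finset.range N, (toMeasurable volume (s.P '' B k)).indicator (w k) y := by
    intro y
    set g : ℝ → ℝ := fun t => ψ (s.Q y + t • e) with hg
    have hgd : ∀ t, deriv g t = fderiv ℝ ψ (s.Q y + t • e) e := fun t =>
      (s.deriv_slice hψ y t).deriv
    have hcline : Continuous fun t : ℝ => s.Q y + t • e := by fun_prop
    have hnorm : ∀ t : ℝ, ‖s.Q y + t • e‖ ^ 2 = ‖y‖ ^ 2 + t ^ 2 := fun t => by
      rw [s.norm_sq, s.P_apply, s.inner_apply]
    have e1 : ∫ t : ℝ, Ω.indicator (fun z => fderiv ℝ ψ z e) (s.Q y + t • e) =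
        ∫ t in {t : ℝ | s.Q y + t • e ∈ Ω}, deriv g t := by
      rw [← integral_indicator (show MeasurableSet {t : ℝ | s.Q y + t • e ∈ Ω} from
        hcline.measurable hΩm)]
      congr 1
      ext t
      simp only [indicator, mem_ofPred_eq, hgd]
    rw [e1]
    by_cases hy : ‖y‖ ≤ T
    · have key := abs_setIntegral_deriv_le (S := {t : ℝ | s.Q y + t • e ∈ F})
        (U := {t : ℝ | s.Q y + t • e ∈ Ω}) (hcline.measurable hΩm)
        (fun t ht => (hcline.tendsto t).eventually (hΩ _ ht)) (g := g) (C := C) (T := T) (r := r)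
        (hψ.comp (by fun_prop)) (fun t => by
          rw [hgd]
          calc |fderiv ℝ ψ (s.Q y + t • e) e| ≤ ‖fderiv ℝ ψ (s.Q y + t • e)‖ * ‖e‖ :=
              (Real.norm_eq_abs _).symm.trans_le (ContinuousLinearMap.le_opNorm _ _)
            _ ≤ C := by rw [s.norm_e, mul_one]; exact hC _)
        hr0.le N hNr (fun t ht => hT _ (by
          refine le_of_sq_le_sq ?_ (norm_nonneg _)
          rw [hnorm]
          nlinarith [sq_abs t, sq_nonneg ‖y‖])) hT0
        (fun k => y ∈ s.P '' B k) (by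
          rintro k ⟨t, ht, htF⟩
          refine ⟨s.Q y + t • e, ⟨htF, ?_, ?_⟩, s.P_apply _ _⟩
          · rwa [s.P_apply]
          · rwa [s.inner_apply])
      rw [← ofReal_norm, Real.norm_eq_abs]
      refine (ENNReal.ofReal_le_ofReal key).trans ?_
      rw [ENNReal.ofReal_sum_of_nonneg (fun k _ => by split_ifs <;> positivity)]
      refine Finset.sum_le_sum fun k _ => ?_
      split_ifs with h
      · rw [indicator_of_mem (subset_toMeasurable _ _ h)]
      · simp
    · have : ∀ t, deriv g t = 0 := by
        intro t
        have hg0 : g = fun _ => 0 := by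
          ext t
          refine hT _ ?_
          refine le_of_sq_le_sq ?_ (norm_nonneg _)
          rw [hnorm]
          nlinarith [sq_nonneg t, not_le.1 hy]
        rw [hg0]; simp
      simp [this]
  calc ‖∫ z in Ω, fderiv ℝ ψ z e‖ₑ
      = ‖∫ y, ∫ t : ℝ, Ω.indicator (fun z => fderiv ℝ ψ z e) (s.Q y + t • e)‖ₑ := by
        rw [← integral_indicator hΩm, s.integral_eq (hint.indicator hΩm)]
    _ ≤ ∫⁻ y, ‖∫ t : ℝ, Ω.indicator (fun z => fderiv ℝ ψ z e) (s.Q y + t • e)‖ₑ :=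
        enorm_integral_le_lintegral_enorm _
    _ ≤ ∫⁻ y, ∑ k ∈ Finset.range N, (toMeasurable volume (s.P '' B k)).indicator (w k) y :=
        lintegral_mono hline
    _ = ∑ k ∈ Finset.range N, ∫⁻ y in s.P '' B k, w k y := by
        rw [lintegral_finsetSum _
          (fun k _ => (hwm k).indicator (measurableSet_toMeasurable _ _))]
        refine Finset.sum_congr rfl fun k _ => ?_
        rw [lintegral_indicator (measurableSet_toMeasurable _ _),
          Measure.restrict_toMeasurable_of_sFinite]
    _ ≤ ∑ k ∈ Finset.range N, ∫⁻ z in B k,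
          ENNReal.ofReal (|ψ z| + 2 * C * r) ∂μHE[d] := by
        refine Finset.sum_le_sum fun k _ => ?_
        refine (lintegral_mono' (s.volume_restrict_image_le (B k)) le_rfl).trans ?_
        rw [lintegral_map (hwm k) s.P.continuous.measurable]
        refine setLIntegral_mono' (hBm k) fun z hz => ?_
        refine ENNReal.ofReal_le_ofReal ?_
        have h1 : ‖s.Q (s.P z) + (-T + k * r) • e - z‖ ≤ r := by
          have h2 : s.Q (s.P z) + (-T + k * r) • e - z =
              ((-T + k * r) - inner ℝ z e) • e := by
            conv_lhs => rw [sub_eq_add_neg]; arg 2; rw [← s.recompose z]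
            module
          rw [h2, norm_smul, s.norm_e, mul_one, Real.norm_eq_abs, abs_le]
          obtain ⟨h3, h4⟩ := hz.2.2
          constructor <;> nlinarith
        have h2 := (hlip (s.Q (s.P z) + (-T + k * r) • e) z).trans
          (mul_le_mul_of_nonneg_left h1 hC0)
        have h3 := abs_sub_abs_le_abs_sub (ψ (s.Q (s.P z) + (-T + k * r) • e)) (ψ z)
        linarith
    _ = ∫⁻ z in ⋃ k ∈ Finset.range N, B k, ENNReal.ofReal (|ψ z| + 2 * C * r) ∂μHE[d] := by
        rw [lintegral_biUnion_finset _ (fun k _ => hBm k)]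
        intro i _ j _ hij
        refine disjoint_left.2 fun z hzi hzj => hij ?_
        obtain ⟨a1, a2⟩ := hzi.2.2
        obtain ⟨b1, b2⟩ := hzj.2.2
        have c1 : (i : ℝ) < j + 1 := by
          by_contra! h
          nlinarith
        have c2 : (j : ℝ) < i + 1 := by
          by_contra! h
          nlinarith
        have c1' : i < j + 1 := by exact_mod_cast c1
        have c2' : j < i + 1 := by exact_mod_cast c2
        omega
    _ ≤ _ := by
        refine lintegral_mono_set ?_
        refine iUnion₂_subset fun k hk z hz => ⟨hz.1, ?_⟩
        rw [mem_closedBall_zero_iff]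
        have hk' : (k : ℝ) + 1 ≤ N := by exact_mod_cast Finset.mem_range.1 hk
        have h1 : (inner ℝ z e : ℝ) ≤ T := by
          have := hz.2.2.2
          nlinarith
        have h2 : -T ≤ (inner ℝ z e : ℝ) := by
          have := hz.2.2.1
          have : 0 ≤ (k : ℝ) * r := by positivity
          linarith
        refine le_of_sq_le_sq ?_ (by positivity)
        rw [s.norm_sq]
        have h3 := hz.2.1
        nlinarith [norm_nonneg (s.P z)]

lemma abs_setIntegral_fderiv_le {F Ω : Set (EuclideanSpace ℝ (Fin n))}
    (hF : MeasurableSet F) (hΩm : MeasurableSet Ω)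
    (hΩ : ∀ z ∉ F, ∀ᶠ z' in nhds z, (z' ∈ Ω ↔ z ∈ Ω))
    (hfin : ∀ R, μHE[d] (F ∩ closedBall 0 R) < ⊤)
    {ψ : EuclideanSpace ℝ (Fin n) → ℝ} (hψ : ContDiff ℝ 1 ψ) (hc : HasCompactSupport ψ) :
    |∫ z in Ω, fderiv ℝ ψ z e| ≤ ∫ z in F, |ψ z| ∂μHE[d] := by
  obtain ⟨T, hT0, hTs⟩ := hc.isCompact.isBounded.subset_ball_lt 0 0
  have hT : ∀ z, T ≤ ‖z‖ → ψ z = 0 := by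
    intro z hz
    by_contra h
    have := mem_ball_zero_iff.1 (hTs (subset_tsupport _ h))
    linarith
  obtain ⟨C, hC⟩ := (hψ.continuous_fderiv one_ne_zero).bounded_above_of_compact_support
    (hc.fderiv (𝕜 := ℝ))
  have hC0 : 0 ≤ C := (norm_nonneg _).trans (hC 0)
  set K := F ∩ closedBall (0 : EuclideanSpace ℝ (Fin n)) (2 * T) with hK
  have : IsFiniteMeasure (μHE[d].restrict K) := ⟨by simpa using hfin (2 * T)⟩
  obtain ⟨D, hD⟩ := hψ.continuous.bounded_above_of_compact_support hc
  have hψi : Integrable (fun z => |ψ z|) (μHE[d].restrict K) :=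
    Integrable.of_bound hψ.continuous.abs.aestronglyMeasurable D
      (Filter.Eventually.of_forall fun z => by simpa using hD z)
  have hKeq : ∫ z in F, |ψ z| ∂μHE[d] = ∫ z in K, |ψ z| ∂μHE[d] := by
    refine (setIntegral_eq_of_subset_of_forall_sdiff_eq_zero (f := fun z => |ψ z|) hF
      inter_subset_left fun z hz => ?_)
    change |ψ z| = 0
    rw [hT z, abs_zero]
    by_contra! h
    exact hz.2 ⟨hz.1, mem_closedBall_zero_iff.2 (by linarith)⟩
  have key : ∀ N : ℕ, |∫ z in Ω, fderiv ℝ ψ z e| ≤ (∫ z in K, |ψ z| ∂μHE[d]) +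
      2 * C * (2 * T / (N + 1 : ℕ)) * (μHE[d].restrict K).real univ := by
    intro N
    have h1 := s.enorm_setIntegral_fderiv_le hF hΩm hΩ hψ hc hT0 hT hC N.succ_pos
    have hi : Integrable (fun z => |ψ z| + 2 * C * (2 * T / (N.succ : ℕ)))
        (μHE[d].restrict K) := hψi.add (integrable_const _)
    have hnn : ∀ z, 0 ≤ |ψ z| + 2 * C * (2 * T / (N.succ : ℕ)) := fun z => by positivity
    rw [← ofReal_integral_eq_lintegral_ofReal hi (Filter.Eventually.of_forall hnn),
      ← ofReal_norm, ENNReal.ofReal_le_ofReal_iff (integral_nonneg hnn),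
      integral_add hψi (integrable_const _), integral_const, smul_eq_mul,
      mul_comm (Measure.real _ _)] at h1
    exact h1
  rw [hKeq]
  have hlim : Filter.Tendsto (fun N : ℕ => (∫ z in K, |ψ z| ∂μHE[d]) +
      2 * C * (2 * T / (N + 1 : ℕ)) * (μHE[d].restrict K).real univ) Filter.atTop
      (nhds ((∫ z in K, |ψ z| ∂μHE[d]) + 2 * C * 0 * (μHE[d].restrict K).real univ)) := by
    refine tendsto_const_nhds.add ((tendsto_const_nhds.mul ?_).mul tendsto_const_nhds)
    exact (tendsto_const_div_atTop_nhds_zero_nat (2 * T)).comp (Filter.tendsto_add_atTop_nat 1)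
  simpa using ge_of_tendsto' hlim key

end UnitSplitting

/-- To bound an additive functional on test functions by `∫ θ g`, it suffices to do so locally up
to an arbitrarily small error in `g`. -/
lemma le_integral_of_locally_le {n : ℕ} {μ : Measure (EuclideanSpace ℝ (Fin n))}
    [IsFiniteMeasureOnCompacts μ] (L : (EuclideanSpace ℝ (Fin n) → ℝ) → ℝ) (L_zero : L 0 = 0)
    (L_add : ∀ ψ φ : EuclideanSpace ℝ (Fin n) → ℝ, ContDiff ℝ 1 ψ → HasCompactSupport ψ →
      ContDiff ℝ 1 φ → HasCompactSupport φ → L (ψ + φ) = L ψ + L φ)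
    {g : EuclideanSpace ℝ (Fin n) → ℝ} (hg : Continuous g)
    (hloc : ∀ ε > 0, ∀ p, ∃ U ∈ nhds p, ∀ ψ : EuclideanSpace ℝ (Fin n) → ℝ, ContDiff ℝ 1 ψ →
      HasCompactSupport ψ → (∀ z, 0 ≤ ψ z) → tsupport ψ ⊆ U → L ψ ≤ ∫ z, ψ z * (g z + ε) ∂μ)
    {θ : EuclideanSpace ℝ (Fin n) → ℝ} (hθ : ContDiff ℝ 1 θ) (hc : HasCompactSupport θ)
    (hθ0 : ∀ z, 0 ≤ θ z) : L θ ≤ ∫ z, θ z * g z ∂μ := by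
  classical
  have L_sum : ∀ (ι : Type) (s : Finset ι) (ψ : ι → EuclideanSpace ℝ (Fin n) → ℝ),
      (∀ i, ContDiff ℝ 1 (ψ i)) → (∀ i, HasCompactSupport (ψ i)) →
      L (∑ i ∈ s, ψ i) = ∑ i ∈ s, L (ψ i) ∧ ContDiff ℝ 1 (∑ i ∈ s, ψ i) ∧
        HasCompactSupport (∑ i ∈ s, ψ i) := by
    intro ι s ψ h1 h2
    induction s using Finset.induction_on with
    | empty => simpa [L_zero] using ⟨contDiff_const (c := (0:ℝ)), HasCompactSupport.zero⟩
    | insert a s ha ih =>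
      rw [Finset.sum_insert ha, Finset.sum_insert ha, L_add _ _ (h1 a) (h2 a) ih.2.1 ih.2.2, ih.1]
      exact ⟨rfl, (h1 a).add ih.2.1, (h2 a).add ih.2.2⟩
  have hint : ∀ ε : ℝ, ∀ ψ : EuclideanSpace ℝ (Fin n) → ℝ, Continuous ψ → HasCompactSupport ψ →
      Integrable (fun z => ψ z * (g z + ε)) μ := fun ε ψ h1 h2 =>
    (h1.mul (hg.add continuous_const)).integrable_of_hasCompactSupport h2.mul_right
  have key : ∀ ε > 0, L θ ≤ ∫ z, θ z * (g z + ε) ∂μ := by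
    intro ε hε
    choose U hU hUL using hloc ε hε
    obtain ⟨t, ht⟩ := hc.isCompact.elim_nhds_subcover (fun p => interior (U p))
      (fun p _ => interior_mem_nhds.2 (hU p))
    obtain ⟨ρ, hρ⟩ := SmoothPartitionOfUnity.exists_isSubordinate
      (modelWithCornersSelf ℝ (EuclideanSpace ℝ (Fin n))) (s := tsupport θ)
      (isClosed_tsupport θ) (fun p : t => interior (U p)) (fun p => isOpen_interior)
      (by simpa [iUnion_subtype] using ht.2)
    set ψ : t → EuclideanSpace ℝ (Fin n) → ℝ := fun i z => ρ i z * θ z with hψ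
    have hψ1 : ∀ i, ContDiff ℝ 1 (ψ i) := fun i =>
      ((ρ i).contMDiff.contDiff.of_le (by exact_mod_cast le_top)).mul hθ
    have hψc : ∀ i, HasCompactSupport (ψ i) := fun i => hc.mul_left
    have hsum : θ = ∑ i, ψ i := by
      ext z
      rw [Finset.sum_apply]
      simp only [hψ, ← Finset.sum_mul]
      by_cases hz : z ∈ tsupport θ
      · have := ρ.sum_eq_one hz
        rw [finsum_eq_sum_of_fintype] at this
        rw [this, one_mul]
      · rw [image_eq_zero_of_notMem_tsupport hz, mul_zero]
    have h1 : L θ = ∑ i, L (ψ i) := by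
      conv_lhs => rw [hsum]
      exact (L_sum _ _ ψ hψ1 hψc).1
    have h2 : ∫ z, θ z * (g z + ε) ∂μ = ∑ i, ∫ z, ψ i z * (g z + ε) ∂μ := by
      rw [← integral_finsetSum _ fun i _ => hint ε _ (hψ1 i).continuous (hψc i)]
      congr 1
      ext z
      conv_lhs => rw [hsum]
      rw [Finset.sum_apply, Finset.sum_mul]
    rw [h1, h2]
    refine Finset.sum_le_sum fun i _ => hUL i.1 _ (hψ1 i) (hψc i)
      (fun z => mul_nonneg (ρ.nonneg i z) (hθ0 z)) ?_
    exact ((tsupport_mul_subset_left (f := ρ i) (g := θ)).trans (hρ i)).trans interior_subset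
  have h1 : Integrable θ μ := hθ.continuous.integrable_of_hasCompactSupport hc
  have h2 : Integrable (fun z => θ z * g z) μ := by simpa using hint 0 θ hθ.continuous hc
  refine le_of_forall_pos_le_add fun ε hε => ?_
  have hI : 0 ≤ ∫ z, θ z ∂μ := integral_nonneg hθ0
  have := key (ε / (∫ z, θ z ∂μ + 1)) (by positivity)
  simp only [mul_add] at this
  rw [integral_add h2 (h1.mul_const _), integral_mul_const] at this
  have h3 : (∫ z, θ z ∂μ) * (ε / (∫ z, θ z ∂μ + 1)) ≤ ε := by
    rw [mul_div_assoc', div_le_iff₀ (by positivity)]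
    nlinarith
  linarith

/-- Divergence of a vector field. -/
noncomputable def divergence {n : ℕ} (η : EuclideanSpace ℝ (Fin n) → EuclideanSpace ℝ (Fin n))
    (z : EuclideanSpace ℝ (Fin n)) : ℝ :=
  ∑ i, (fderiv ℝ η z (EuclideanSpace.single i 1)) i

section divergence
variable {n : ℕ} {η ζ : EuclideanSpace ℝ (Fin n) → EuclideanSpace ℝ (Fin n)}
  {ψ : EuclideanSpace ℝ (Fin n) → ℝ} {z : EuclideanSpace ℝ (Fin n)}

lemma divergence_add (h1 : DifferentiableAt ℝ η z) (h2 : DifferentiableAt ℝ ζ z) :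
    divergence (η + ζ) z = divergence η z + divergence ζ z := by
  simp [divergence, fderiv_add h1 h2, Finset.sum_add_distrib]

lemma divergence_smul (h1 : DifferentiableAt ℝ ψ z) (h2 : DifferentiableAt ℝ η z) :
    divergence (fun z => ψ z • η z) z = fderiv ℝ ψ z (η z) + ψ z * divergence η z := by
  simp only [divergence]
  rw [fderiv_fun_smul h1 h2]
  simp only [add_apply, smul_apply,
    ContinuousLinearMap.smulRight_apply, PiLp.add_apply, PiLp.smul_apply, smul_eq_mul,
    Finset.sum_add_distrib, Finset.mul_sum]
  rw [add_comm]
  congr 1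
  conv_rhs => rw [← (EuclideanSpace.basisFun (Fin n) ℝ).sum_repr (η z)]
  simp [map_sum, mul_comm]

lemma divergence_eq_sum (h : DifferentiableAt ℝ η z) :
    divergence η z = ∑ i, fderiv ℝ (fun z => η z i) z (EuclideanSpace.single i 1) := by
  refine Finset.sum_congr rfl fun i _ => ?_
  have := ((EuclideanSpace.proj (𝕜 := ℝ) i).hasFDerivAt.comp z h.hasFDerivAt).fderiv
  change fderiv ℝ (fun z => η z i) z = _ at this
  rw [this]; rfl

lemma continuous_divergence (h : ContDiff ℝ 1 η) : Continuous (divergence η) := by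
  have := h.continuous_fderiv one_ne_zero
  unfold divergence
  fun_prop

lemma integrable_divergence (h : ContDiff ℝ 1 η) (hc : HasCompactSupport η) :
    Integrable (divergence η) := by
  refine (continuous_divergence h).integrable_of_hasCompactSupport
    (HasCompactSupport.intro hc.isCompact fun z hz => ?_)
  have : fderiv ℝ η z = 0 := by
    by_contra h
    exact hz (support_fderiv_subset ℝ h)
  simp [divergence, this]

end divergence

/-- `Ω` is measurable and locally constant off the closed set `F`, whose `d`-dimensional measure
is locally finite. -/
structure SeparatedBy {n : ℕ} (d : ℕ) (Ω F : Set (EuclideanSpace ℝ (Fin n))) : Prop where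
  isClosed : IsClosed F
  measurableSet : MeasurableSet Ω
  eventually_mem_iff : ∀ z ∉ F, ∀ᶠ z' in nhds z, (z' ∈ Ω ↔ z ∈ Ω)
  measure_lt_top : ∀ R, μHE[d] (F ∩ closedBall 0 R) < ⊤

lemma integrable_divergence_smul {n : ℕ} {ψ : EuclideanSpace ℝ (Fin n) → ℝ}
    {ξ : EuclideanSpace ℝ (Fin n) → EuclideanSpace ℝ (Fin n)} (hψ : ContDiff ℝ 1 ψ)
    (hc : HasCompactSupport ψ) (hξ : ContDiff ℝ 1 ξ) :
    Integrable (divergence fun z => ψ z • ξ z) :=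
  integrable_divergence (hψ.smul hξ) hc.smul_right

lemma flux_add {n : ℕ} {Ω : Set (EuclideanSpace ℝ (Fin n))} {θ φ : EuclideanSpace ℝ (Fin n) → ℝ}
    {ξ : EuclideanSpace ℝ (Fin n) → EuclideanSpace ℝ (Fin n)} (hξ : ContDiff ℝ 1 ξ)
    (h1 : ContDiff ℝ 1 θ) (h2 : HasCompactSupport θ) (h3 : ContDiff ℝ 1 φ)
    (h4 : HasCompactSupport φ) :
    ∫ z in Ω, divergence (fun z => (θ + φ) z • ξ z) z =
      (∫ z in Ω, divergence (fun z => θ z • ξ z) z) +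
        ∫ z in Ω, divergence (fun z => φ z • ξ z) z := by
  rw [← integral_add (integrable_divergence_smul h1 h2 hξ).integrableOn
    (integrable_divergence_smul h3 h4 hξ).integrableOn]
  congr 1
  ext z
  refine Eq.trans ?_ (divergence_add ((h1.smul hξ).differentiable one_ne_zero z)
    ((h3.smul hξ).differentiable one_ne_zero z))
  congr 1
  ext z : 1
  exact add_smul _ _ _

namespace SeparatedBy
variable {n d : ℕ} {Ω F : Set (EuclideanSpace ℝ (Fin n))} (h : SeparatedBy d Ω F)
  {ψ : EuclideanSpace ℝ (Fin n) → ℝ} {ξ : EuclideanSpace ℝ (Fin n) → EuclideanSpace ℝ (Fin n)}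
include h

lemma isFiniteMeasureOnCompacts : IsFiniteMeasureOnCompacts (μHE[d].restrict F) := by
  refine ⟨fun K hK => ?_⟩
  obtain ⟨R, hR⟩ := hK.isBounded.subset_closedBall 0
  rw [Measure.restrict_apply hK.measurableSet, inter_comm]
  exact (measure_mono (inter_subset_inter_right _ hR)).trans_lt (h.measure_lt_top R)

lemma abs_setIntegral_fderiv_le (hn : n = d + 1) (hψ : ContDiff ℝ 1 ψ) (hc : HasCompactSupport ψ)
    (v : EuclideanSpace ℝ (Fin n)) :
    |∫ z in Ω, fderiv ℝ ψ z v| ≤ ‖v‖ * ∫ z in F, |ψ z| ∂μHE[d] := by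
  obtain rfl | hv := eq_or_ne v 0
  · simp
  have hv' : ‖v‖ ≠ 0 := norm_ne_zero_iff.2 hv
  obtain ⟨s⟩ := exists_unitSplitting hn ((‖v‖)⁻¹ • v) (by rw [norm_smul]; simp [hv'])
  have := s.abs_setIntegral_fderiv_le h.isClosed.measurableSet h.measurableSet
    h.eventually_mem_iff h.measure_lt_top hψ hc
  simp only [map_smul, smul_eq_mul] at this
  rw [integral_const_mul, abs_mul, abs_of_pos (by positivity), inv_mul_le_iff₀ (by positivity)]
    at this
  exact this

lemma abs_flux_le_sum (hn : n = d + 1) (hψ : ContDiff ℝ 1 ψ) (hc : HasCompactSupport ψ)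
    (hξ : ContDiff ℝ 1 ξ) :
    |∫ z in Ω, divergence (fun z => ψ z • ξ z) z| ≤ ∑ i, ∫ z in F, |ψ z * ξ z i| ∂μHE[d] := by
  have h1 : ∀ i, ContDiff ℝ 1 fun z => ψ z * ξ z i := fun i =>
    hψ.mul ((EuclideanSpace.proj (𝕜 := ℝ) i).contDiff.comp hξ)
  have h2 : ∀ i, HasCompactSupport fun z => ψ z * ξ z i := fun i => hc.mul_right
  have h3 : ∀ z, divergence (fun z => ψ z • ξ z) z =
      ∑ i, fderiv ℝ (fun z => ψ z * ξ z i) z (EuclideanSpace.single i 1) := fun z => by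
    exact divergence_eq_sum ((hψ.smul hξ).differentiable one_ne_zero z)
  simp_rw [h3]
  rw [integral_finsetSum _ fun i _ =>
    (UnitSplitting.integrable_fderiv_apply (h1 i) (h2 i) _).integrableOn]
  refine (Finset.abs_sum_le_sum_abs _ _).trans (Finset.sum_le_sum fun i _ => ?_)
  simpa using h.abs_setIntegral_fderiv_le hn (h1 i) (h2 i) (EuclideanSpace.single i 1)

lemma abs_flux_sub_le (hn : n = d + 1) (hξ : ContDiff ℝ 1 ξ) {ε : ℝ} (hε : 0 < ε)
    (p : EuclideanSpace ℝ (Fin n)) :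
    ∃ U ∈ nhds p, ∀ ψ : EuclideanSpace ℝ (Fin n) → ℝ, ContDiff ℝ 1 ψ → HasCompactSupport ψ →
      (∀ z, 0 ≤ ψ z) → tsupport ψ ⊆ U →
      |(∫ z in Ω, divergence (fun z => ψ z • ξ z) z) - ∫ z in Ω, fderiv ℝ ψ z (ξ p)| ≤
        ε * ∫ z in F, ψ z ∂μHE[d] := by
  have hfin := h.isFiniteMeasureOnCompacts
  refine ⟨{z | ‖ξ z - ξ p‖ < ε / (n + 1)}, ?_, fun ψ hψ hc hψ0 hs => ?_⟩
  · have : Filter.Tendsto (fun z => ‖ξ z - ξ p‖) (nhds p) (nhds 0) := by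
      simpa using ((hξ.continuous.sub continuous_const).norm.tendsto p : Filter.Tendsto
        (fun z => ‖ξ z - ξ p‖) (nhds p) (nhds ‖ξ p - ξ p‖))
    exact this.eventually_lt_const (by positivity)
  have e1 : ∀ z, divergence (fun z => ψ z • ξ z) z - fderiv ℝ ψ z (ξ p) =
      divergence (fun z => ψ z • (ξ z - ξ p)) z := by
    intro z
    have d1 := hψ.differentiable one_ne_zero z
    have d2 := hξ.differentiable one_ne_zero z
    rw [divergence_smul d1 d2, divergence_smul d1 (d2.sub_const _), map_sub]
    have : divergence (fun z => ξ z - ξ p) z = divergence ξ z := by simp [divergence, fderiv_sub_const]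
    rw [this]; ring
  have hξ' : ContDiff ℝ 1 fun z => ξ z - ξ p := hξ.sub contDiff_const
  rw [← integral_sub (integrable_divergence_smul hψ hc hξ).integrableOn
    (UnitSplitting.integrable_fderiv_apply hψ hc _).integrableOn]
  simp_rw [e1]
  have hψi : Integrable ψ (μHE[d].restrict F) := hψ.continuous.integrable_of_hasCompactSupport hc
  have hI : 0 ≤ ∫ z in F, ψ z ∂μHE[d] := integral_nonneg hψ0
  refine (h.abs_flux_le_sum hn hψ hc hξ').trans ?_
  calc _ ≤ ∑ i : Fin n, ∫ z in F, ε / (n + 1) * ψ z ∂μHE[d] := by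
        refine Finset.sum_le_sum fun i _ => integral_mono ?_ (hψi.const_mul _) fun z => ?_
        · refine Continuous.integrable_of_hasCompactSupport ?_ hc.mul_right.abs
          exact (hψ.continuous.mul
            ((EuclideanSpace.proj (𝕜 := ℝ) i).continuous.comp hξ'.continuous)).abs
        · change |ψ z * (ξ z - ξ p) i| ≤ _
          by_cases hz : ψ z = 0
          · simp [hz]
          · have h1 := hs (subset_tsupport _ hz)
            have h2 := PiLp.norm_apply_le (ξ z - ξ p) i
            rw [abs_mul, abs_of_nonneg (hψ0 z), mul_comm]
            exact mul_le_mul_of_nonneg_right (h2.trans (le_of_lt h1)) (hψ0 z)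
    _ = n * (ε / (n + 1)) * ∫ z in F, ψ z ∂μHE[d] := by
        simp [integral_const_mul]; ring
    _ ≤ _ := by
        refine mul_le_mul_of_nonneg_right ?_ hI
        rw [mul_div_assoc', div_le_iff₀ (by positivity)]
        nlinarith

lemma flux_le (hn : n = d + 1) (hψ : ContDiff ℝ 1 ψ) (hc : HasCompactSupport ψ)
    (hψ0 : ∀ z, 0 ≤ ψ z) (hξ : ContDiff ℝ 1 ξ) :
    ∫ z in Ω, divergence (fun z => ψ z • ξ z) z ≤ ∫ z in F, ψ z * ‖ξ z‖ ∂μHE[d] := by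
  have hfin := h.isFiniteMeasureOnCompacts
  refine le_integral_of_locally_le
    (fun θ => ∫ z in Ω, divergence (fun z => θ z • ξ z) z) ?_ ?_ hξ.continuous.norm ?_ hψ hc hψ0
  · simp [divergence]
  · intro θ φ h1 h2 h3 h4
    exact flux_add hξ h1 h2 h3 h4
  · intro ε hε p
    obtain ⟨U, hU, hUψ⟩ := h.abs_flux_sub_le hn hξ (half_pos hε) p
    refine ⟨U ∩ {z | ‖ξ p‖ < ‖ξ z‖ + ε / 2}, Filter.inter_mem hU ?_, fun ψ h1 h2 h3 h4 => ?_⟩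
    · exact (hξ.continuous.norm.add continuous_const).continuousAt.eventually_const_lt
        (show ‖ξ p‖ < ‖ξ p‖ + ε / 2 by linarith)
    have b1 := (abs_le.1 (hUψ ψ h1 h2 h3 (h4.trans inter_subset_left))).2
    have b2 := (abs_le.1 (h.abs_setIntegral_fderiv_le hn h1 h2 (ξ p))).2
    simp_rw [abs_of_nonneg (h3 _)] at b2
    have b3 : (‖ξ p‖ + ε / 2) * ∫ z in F, ψ z ∂μHE[d] ≤
        ∫ z in F, ψ z * (‖ξ z‖ + ε) ∂μHE[d] := by
      rw [← integral_const_mul]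
      refine integral_mono ((h1.continuous.integrable_of_hasCompactSupport h2).const_mul _)
        ((h1.continuous.mul
          (hξ.continuous.norm.add continuous_const)).integrable_of_hasCompactSupport
            h2.mul_right) fun z => ?_
      by_cases hz : ψ z = 0
      · simp [hz]
      · have h5 : ‖ξ p‖ < ‖ξ z‖ + ε / 2 := (h4 (subset_tsupport _ hz)).2
        change _ * ψ z ≤ ψ z * (‖ξ z‖ + ε)
        nlinarith [h3 z]
    linarith

end SeparatedBy

namespace UnitSplitting
variable {n d : ℕ} {e : EuclideanSpace ℝ (Fin n)} (s : UnitSplitting d e)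
include s

lemma measure_inter_preimage_le {S : Set (EuclideanSpace ℝ (Fin n))} {K : ℝ≥0}
    (hS : ∀ z ∈ S, ∀ z' ∈ S, ‖z - z'‖ ≤ K * ‖s.P (z - z')‖) (T : Set (EuclideanSpace ℝ (Fin d))) :
    μHE[d] (S ∩ s.P ⁻¹' T) ≤ (K : ENNReal) ^ d * volume T := by
  have hinj : InjOn s.P S := by
    intro z hz z' hz' h
    have := hS z hz z' hz'
    rw [map_sub, h, sub_self, norm_zero, mul_zero] at this
    exact sub_eq_zero.1 (norm_le_zero_iff.1 this)
  have hlip : LipschitzOnWith K (Function.invFunOn s.P S) (s.P '' S) := by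
    refine LipschitzOnWith.of_dist_le_mul ?_
    rintro _ ⟨z, hz, rfl⟩ _ ⟨z', hz', rfl⟩
    rw [hinj.leftInvOn_invFunOn hz, hinj.leftInvOn_invFunOn hz', dist_eq_norm, dist_eq_norm,
      ← map_sub]
    exact hS z hz z' hz'
  have h1 : S ∩ s.P ⁻¹' T = Function.invFunOn s.P S '' (s.P '' (S ∩ s.P ⁻¹' T)) := by
    rw [← image_comp]
    ext z; constructor
    · intro hz; exact ⟨z, hz, hinj.leftInvOn_invFunOn hz.1⟩
    · rintro ⟨z', hz', rfl⟩
      change Function.invFunOn s.P S (s.P z') ∈ _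
      rwa [hinj.leftInvOn_invFunOn hz'.1]
  rw [h1]
  refine (euclideanHausdorffMeasure_image_le_of_lipschitzOnWith
    (hlip.mono (image_mono inter_subset_left)) d).trans ?_
  rw [EuclideanSpace.euclideanHausdorffMeasure_eq_volume]
  gcongr
  rintro _ ⟨z, hz, rfl⟩
  exact hz.2

/-- If `S` is a Lipschitz graph in direction `e` and the integral of `f` along each line in
direction `e` dominates `ψ` on `S`, then `∫ f` dominates `∫ ψ` over `S`. -/
lemma setIntegral_le_of_slices {S : Set (EuclideanSpace ℝ (Fin n))} (hSm : MeasurableSet S)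
    {K : ℝ≥0} (hS : ∀ z ∈ S, ∀ z' ∈ S, ‖z - z'‖ ≤ K * ‖s.P (z - z')‖)
    {f ψ : EuclideanSpace ℝ (Fin n) → ℝ} (hf : Integrable f)
    (hf0 : ∀ y, 0 ≤ ∫ t : ℝ, f (s.Q y + t • e)) (hψ : ∀ z, 0 ≤ ψ z)
    (hψi : IntegrableOn ψ S μHE[d])
    (hfψ : ∀ z ∈ S, ψ z ≤ ∫ t : ℝ, f (s.Q (s.P z) + t • e)) :
    ∫ z in S, ψ z ∂μHE[d] ≤ (K : ℝ) ^ d * ∫ z, f z := by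
  set G : EuclideanSpace ℝ (Fin d) → ℝ := fun y => ∫ t : ℝ, f (s.Q y + t • e) with hG
  have hGi : Integrable G := s.integrable_slice hf
  have hmap : (μHE[d].restrict S).map s.P ≤ (K : ENNReal) ^ d • volume := by
    refine Measure.le_iff.2 fun T hT => ?_
    rw [Measure.map_apply s.P.continuous.measurable hT,
      Measure.restrict_apply (s.P.continuous.measurable hT), inter_comm]
    simpa using s.measure_inter_preimage_le hS T
  have hac : (μHE[d].restrict S).map s.P ≪ volume := by
    refine Measure.AbsolutelyContinuous.mk fun T _ hT => ?_
    refine le_antisymm ((hmap T).trans ?_) bot_le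
    simp [hT]
  have h0 : 0 ≤ ∫ z, f z := by
    rw [s.integral_eq hf]; exact integral_nonneg hf0
  have key : ENNReal.ofReal (∫ z in S, ψ z ∂μHE[d]) ≤
      ENNReal.ofReal ((K : ℝ) ^ d * ∫ z, f z) := by
    rw [ofReal_integral_eq_lintegral_ofReal hψi (Filter.Eventually.of_forall hψ)]
    calc ∫⁻ z in S, ENNReal.ofReal (ψ z) ∂μHE[d]
        ≤ ∫⁻ z in S, ENNReal.ofReal (G (s.P z)) ∂μHE[d] :=
          setLIntegral_mono' hSm fun z hz => ENNReal.ofReal_le_ofReal (hfψ z hz)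
      _ = ∫⁻ y, ENNReal.ofReal (G y) ∂((μHE[d].restrict S).map s.P) := by
          rw [lintegral_map' ((hGi.aestronglyMeasurable.aemeasurable.ennreal_ofReal).mono_ac hac)
            s.P.continuous.aemeasurable]
      _ ≤ ∫⁻ y, ENNReal.ofReal (G y) ∂((K : ENNReal) ^ d • volume) :=
          lintegral_mono' hmap le_rfl
      _ = _ := by
          rw [lintegral_smul_measure, ← ofReal_integral_eq_lintegral_ofReal hGi
            (Filter.Eventually.of_forall hf0), ← s.integral_eq hf, ENNReal.ofReal_mul (by positivity),
            ENNReal.ofReal_pow (by positivity), smul_eq_mul]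
          simp
  exact (ENNReal.ofReal_le_ofReal_iff (by positivity)).1 key

end UnitSplitting

/-- `M` is a symmetric linear involution. -/
structure IsSymmInvolution {n : ℕ} (M : EuclideanSpace ℝ (Fin n) →L[ℝ] EuclideanSpace ℝ (Fin n)) :
    Prop where
  symm : ∀ z w, (inner ℝ (M z) w : ℝ) = inner ℝ z (M w)
  invol : ∀ z, M (M z) = z

namespace IsSymmInvolution
variable {n d : ℕ} {M : EuclideanSpace ℝ (Fin n) →L[ℝ] EuclideanSpace ℝ (Fin n)}
  (hM : IsSymmInvolution M)
include hM

lemma norm_map (z : EuclideanSpace ℝ (Fin n)) : ‖M z‖ = ‖z‖ := by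
  rw [← sq_eq_sq₀ (norm_nonneg _) (norm_nonneg _), ← real_inner_self_eq_norm_sq, hM.symm, hM.invol,
    real_inner_self_eq_norm_sq]

lemma quadratic_sub (z w : EuclideanSpace ℝ (Fin n)) :
    (inner ℝ z (M z) : ℝ) - inner ℝ w (M w) = inner ℝ (z - w) (M (z + w)) := by
  rw [map_add, inner_sub_left, inner_add_right, inner_add_right, ← hM.symm z w]
  linarith [real_inner_comm (M z) w]

/-- The part of the cone `⟪z, M z⟫ = 0` close to a given direction is a Lipschitz graph. -/
lemma norm_sub_le {u z z' : EuclideanSpace ℝ (Fin n)} (s : UnitSplitting d (M u))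
    (hz : (inner ℝ z (M z) : ℝ) = 0) (hz' : (inner ℝ z' (M z') : ℝ) = 0)
    (h : ‖z‖ / 2 ≤ inner ℝ z u) (h' : ‖z'‖ / 2 ≤ inner ℝ z' u) :
    ‖z - z'‖ ≤ (3 : ℝ≥0) * ‖s.P (z - z')‖ := by
  have h1 := hM.quadratic_sub z z'
  rw [hz, hz', sub_zero] at h1
  obtain h0 | h0 := eq_or_ne (‖z‖ + ‖z'‖) 0
  · have a1 : ‖z‖ = 0 := by linarith [norm_nonneg z, norm_nonneg z']
    have a2 : ‖z'‖ = 0 := by linarith [norm_nonneg z, norm_nonneg z']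
    rw [norm_eq_zero] at a1 a2
    simp [a1, a2]
  have h0' : 0 < ‖z‖ + ‖z'‖ := lt_of_le_of_ne (by positivity) h0.symm
  set t : ℝ := inner ℝ (z - z') (M u) with ht
  have hrec := s.recompose (z - z')
  have hPn := s.norm_sq (z - z')
  have hQ : ‖s.Q (s.P (z - z'))‖ = ‖s.P (z - z')‖ := by
    have b1 := s.norm_sq (s.Q (s.P (z - z')))
    have b2 := s.P_apply (s.P (z - z')) 0
    have b3 := s.inner_apply (s.P (z - z')) 0
    rw [zero_smul, add_zero] at b2 b3
    rw [b2, b3] at b1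
    exact (sq_eq_sq₀ (norm_nonneg _) (norm_nonneg _)).1 (by linarith)
  rw [← ht] at hrec hPn
  rw [← hrec, inner_add_left, inner_smul_left, hM.symm u, hM.invol] at h1
  simp only [conj_trivial] at h1
  have h2 : ‖z‖ / 2 + ‖z'‖ / 2 ≤ inner ℝ u (z + z') := by
    rw [inner_add_right, real_inner_comm, real_inner_comm z']; linarith
  have h3 := abs_real_inner_le_norm (s.Q (s.P (z - z'))) (M (z + z'))
  rw [hM.norm_map, hQ] at h3
  have h4 := norm_add_le z z'
  have h5 : |t| * (inner ℝ u (z + z') : ℝ) ≤ ‖s.P (z - z')‖ * ‖z + z'‖ := by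
    calc |t| * (inner ℝ u (z + z') : ℝ) ≤ |t * (inner ℝ u (z + z') : ℝ)| := by
          rw [abs_mul]; gcongr; exact le_abs_self _
      _ = |(inner ℝ (s.Q (s.P (z - z'))) (M (z + z')) : ℝ)| := by
          rw [← abs_neg]; congr 1; linarith
      _ ≤ _ := h3
  have h6 : |t| ≤ 2 * ‖s.P (z - z')‖ := by
    have c1 : |t| * (‖z‖ / 2 + ‖z'‖ / 2) ≤ ‖s.P (z - z')‖ * (‖z‖ + ‖z'‖) :=
      (mul_le_mul_of_nonneg_left h2 (abs_nonneg t)).trans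
        (h5.trans (mul_le_mul_of_nonneg_left h4 (norm_nonneg _)))
    have c2 : |t| * (‖z‖ + ‖z'‖) ≤ 2 * ‖s.P (z - z')‖ * (‖z‖ + ‖z'‖) := by linarith
    exact le_of_mul_le_mul_right c2 h0'
  refine le_of_sq_le_sq ?_ (by positivity)
  rw [hPn, ← sq_abs t]
  push_cast
  nlinarith [abs_nonneg t, norm_nonneg (s.P (z - z'))]

lemma measure_cone_lt_top (hn : n = d + 1) (R : ℝ) :
    μHE[d] ({z | (inner ℝ z (M z) : ℝ) = 0} ∩ closedBall 0 R) < ⊤ := by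
  classical
  set S : EuclideanSpace ℝ (Fin n) → Set (EuclideanSpace ℝ (Fin n)) := fun u =>
    {z | (inner ℝ z (M z) : ℝ) = 0 ∧ ‖z‖ / 2 ≤ inner ℝ z u} with hS
  have hSfin : ∀ u, ‖u‖ = 1 → μHE[d] (S u ∩ closedBall 0 R) < ⊤ := by
    intro u hu
    obtain ⟨s⟩ := exists_unitSplitting hn (M u) (by rw [hM.norm_map, hu])
    have h1 := s.measure_inter_preimage_le (S := S u) (K := 3)
      (fun z hz z' hz' => hM.norm_sub_le s hz.1 hz'.1 hz.2 hz'.2) (closedBall 0 R)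
    refine (measure_mono ?_).trans_lt (h1.trans_lt ?_)
    · refine inter_subset_inter_right _ fun z hz => ?_
      rw [mem_preimage, mem_closedBall_zero_iff]
      exact (s.norm_P_le z).trans (mem_closedBall_zero_iff.1 hz)
    · exact ENNReal.mul_lt_top (by finiteness) measure_closedBall_lt_top
  have hn0 : 0 < n := by omega
  set u₀ : EuclideanSpace ℝ (Fin n) := EuclideanSpace.single ⟨0, hn0⟩ 1 with hu₀
  obtain ⟨t, ht, htc⟩ := (isCompact_sphere (0 : EuclideanSpace ℝ (Fin n)) 1).elim_nhds_subcover
    (fun u => {z | 1 / 2 < (inner ℝ z u : ℝ)}) (fun u hu => by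
      have hu' : ‖u‖ = 1 := by simpa using hu
      refine (Continuous.inner continuous_id continuous_const).continuousAt.eventually_const_lt ?_
      simp [hu']
      norm_num)
  have hcov : {z | (inner ℝ z (M z) : ℝ) = 0} ∩ closedBall 0 R ⊆
      ⋃ u ∈ insert u₀ t, S u ∩ closedBall 0 R := by
    rintro z ⟨hz, hzR⟩
    simp only [mem_iUnion]
    obtain rfl | h0 := eq_or_ne z 0
    · exact ⟨u₀, Finset.mem_insert_self _ _, ⟨hz, by simp⟩, hzR⟩
    · have hz0 : 0 < ‖z‖ := norm_pos_iff.2 h0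
      have := htc (show (‖z‖)⁻¹ • z ∈ sphere (0 : EuclideanSpace ℝ (Fin n)) 1 by
        simp [norm_smul, hz0.ne'])
      simp only [mem_iUnion] at this
      obtain ⟨u, hu, hzu⟩ := this
      refine ⟨u, Finset.mem_insert_of_mem hu, ⟨hz, ?_⟩, hzR⟩
      rw [mem_ofPred_eq, inner_smul_left, conj_trivial, inv_mul_eq_div, lt_div_iff₀ hz0] at hzu
      linarith
  refine (measure_mono hcov).trans_lt ?_
  refine (measure_biUnion_finset_le _ _).trans_lt ?_
  refine ENNReal.sum_lt_top.2 fun u hu => hSfin u ?_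
  obtain rfl | hu := Finset.mem_insert.1 hu
  · simp [hu₀]
  · simpa using ht u hu

lemma separatedBy (hn : n = d + 1) :
    SeparatedBy d {z | (inner ℝ z (M z) : ℝ) < 0} {z | (inner ℝ z (M z) : ℝ) = 0} := by
  have hcont : Continuous fun z => (inner ℝ z (M z) : ℝ) := continuous_id.inner M.continuous
  refine ⟨isClosed_eq hcont continuous_const, (isOpen_lt hcont continuous_const).measurableSet,
    fun z hz => ?_, hM.measure_cone_lt_top hn⟩
  obtain h | h := lt_or_gt_of_ne (show (inner ℝ z (M z) : ℝ) ≠ 0 from hz)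
  · filter_upwards [hcont.continuousAt.eventually_lt_const h] with z' hz'
    exact ⟨fun _ => h, fun _ => hz'⟩
  · filter_upwards [hcont.continuousAt.eventually_const_lt h] with z' hz'
    exact ⟨fun h' => absurd h' (not_lt.2 hz'.le), fun h' => absurd h' (not_lt.2 h.le)⟩

end IsSymmInvolution

lemma tendsto_inv_sqrt_one_sub_sq_pow (d : ℕ) :
    Filter.Tendsto (fun κ : ℝ => ((Real.sqrt (1 - κ ^ 2))⁻¹) ^ d) (nhds 0) (nhds 1) := by
  have : ContinuousAt (fun κ : ℝ => ((Real.sqrt (1 - κ ^ 2))⁻¹) ^ d) 0 := by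
    refine ContinuousAt.pow (ContinuousAt.inv₀ (by fun_prop) (by simp)) _
  simpa using this.tendsto

namespace IsSymmInvolution
variable {n d : ℕ} {M : EuclideanSpace ℝ (Fin n) →L[ℝ] EuclideanSpace ℝ (Fin n)}
  (hM : IsSymmInvolution M)
include hM

lemma norm_add_sub_le {p z z' : EuclideanSpace ℝ (Fin n)} {κ : ℝ}
    (hz : z ∈ ball p (κ * ‖p‖)) (hz' : z' ∈ ball p (κ * ‖p‖)) :
    ‖M (z + z') - (2 : ℝ) • M p‖ ≤ 2 * (κ * ‖p‖) := by
  have : M (z + z') - (2 : ℝ) • M p = M ((z - p) + (z' - p)) := by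
    simp only [map_add, map_sub]; module
  rw [this, hM.norm_map]
  rw [mem_ball, dist_eq_norm] at hz hz'
  linarith [norm_add_le (z - p) (z' - p)]

/-- Near a nonzero point `p` of the cone, the cone is a Lipschitz graph over the orthogonal
complement of `M p`. -/
lemma norm_sub_le_of_mem_ball {p z z' : EuclideanSpace ℝ (Fin n)} (hp : p ≠ 0) {κ : ℝ}
    (hκ0 : 0 < κ) (hκ : κ < 1) (s : UnitSplitting d ((‖p‖)⁻¹ • M p))
    (hz : z ∈ ball p (κ * ‖p‖)) (hz' : z' ∈ ball p (κ * ‖p‖))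
    (hq : (inner ℝ z (M z) : ℝ) = inner ℝ z' (M z')) :
    ‖z - z'‖ ≤ (Real.sqrt (1 - κ ^ 2))⁻¹ * ‖s.P (z - z')‖ := by
  have hp0 : 0 < ‖p‖ := norm_pos_iff.2 hp
  have h1 := hM.quadratic_sub z z'
  rw [hq, sub_self] at h1
  have h2 := abs_real_inner_le_norm (z - z') (M (z + z') - (2 : ℝ) • M p)
  rw [inner_sub_right, ← h1, zero_sub, abs_neg, inner_smul_right, abs_mul, abs_two] at h2
  have h3 := h2.trans (mul_le_mul_of_nonneg_left (hM.norm_add_sub_le hz hz') (norm_nonneg _))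
  have hN := s.norm_sq (z - z')
  set t : ℝ := inner ℝ (z - z') ((‖p‖)⁻¹ • M p) with ht
  have ht' : (inner ℝ (z - z') (M p) : ℝ) = ‖p‖ * t := by
    rw [ht, inner_smul_right]; field_simp
  rw [ht', abs_mul, abs_of_pos hp0] at h3
  have h4 : |t| ≤ κ * ‖z - z'‖ := by
    have : |t| * (2 * ‖p‖) ≤ κ * ‖z - z'‖ * (2 * ‖p‖) := by linarith
    exact le_of_mul_le_mul_right this (by positivity)
  have h5 : t ^ 2 ≤ κ ^ 2 * ‖z - z'‖ ^ 2 := by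
    rw [← sq_abs, ← mul_pow]; gcongr
  have hpos : 0 < 1 - κ ^ 2 := by nlinarith
  rw [← div_eq_inv_mul, le_div_iff₀ (Real.sqrt_pos.2 hpos)]
  refine le_of_sq_le_sq ?_ (norm_nonneg _)
  rw [mul_pow, Real.sq_sqrt hpos.le]
  linarith

lemma quadratic_lt {p y : EuclideanSpace ℝ (Fin n)} (hp : p ≠ 0) {κ : ℝ} (hκ : κ < 1)
    {t t' : ℝ} (htt : t < t')
    (hz : y + t • ((‖p‖)⁻¹ • M p) ∈ ball p (κ * ‖p‖))
    (hz' : y + t' • ((‖p‖)⁻¹ • M p) ∈ ball p (κ * ‖p‖)) :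
    (inner ℝ (y + t • ((‖p‖)⁻¹ • M p)) (M (y + t • ((‖p‖)⁻¹ • M p))) : ℝ) <
      inner ℝ (y + t' • ((‖p‖)⁻¹ • M p)) (M (y + t' • ((‖p‖)⁻¹ • M p))) := by
  have hp0 : 0 < ‖p‖ := norm_pos_iff.2 hp
  have h1 := hM.quadratic_sub (y + t' • ((‖p‖)⁻¹ • M p)) (y + t • ((‖p‖)⁻¹ • M p))
  have h2 := hM.norm_add_sub_le hz' hz
  set w := M (y + t' • ((‖p‖)⁻¹ • M p) + (y + t • ((‖p‖)⁻¹ • M p)))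
  have h3 : y + t' • ((‖p‖)⁻¹ • M p) - (y + t • ((‖p‖)⁻¹ • M p)) =
    (t' - t) • ((‖p‖)⁻¹ • M p) := by module
  rw [h3, inner_smul_left, conj_trivial] at h1
  have he : ‖(‖p‖)⁻¹ • M p‖ = 1 := by
    rw [norm_smul, hM.norm_map, norm_inv, norm_norm, inv_mul_cancel₀ hp0.ne']
  have h4 := abs_real_inner_le_norm ((‖p‖)⁻¹ • M p) (w - (2 : ℝ) • M p)
  rw [he, one_mul, inner_sub_right, inner_smul_right, inner_smul_left, inner_smul_left,
    real_inner_self_eq_norm_sq, hM.norm_map] at h4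
  have h5 := (abs_le.1 (h4.trans h2)).1
  simp only [conj_trivial] at h5
  have h6 : (‖p‖)⁻¹ * ‖p‖ ^ 2 = ‖p‖ := by field_simp
  rw [h6] at h5
  have h7 : 0 < (inner ℝ ((‖p‖)⁻¹ • M p) w : ℝ) := by
    rw [inner_smul_left]
    simp only [conj_trivial]
    nlinarith
  nlinarith [mul_pos (sub_pos.2 htt) h7]

/-- The lower flux bound for a constant field near a nonzero point of the cone. -/
lemma setIntegral_le_flux (hn : n = d + 1) {p : EuclideanSpace ℝ (Fin n)} (hp : p ≠ 0)
    {δ : ℝ} (hδ : 0 < δ) (hδ1 : δ < 1) :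
    ∃ U ∈ nhds p, ∀ ψ : EuclideanSpace ℝ (Fin n) → ℝ, ContDiff ℝ 1 ψ → HasCompactSupport ψ →
      (∀ z, 0 ≤ ψ z) → tsupport ψ ⊆ U →
      (1 - δ) * ∫ z in {z | (inner ℝ z (M z) : ℝ) = 0}, ψ z ∂μHE[d] ≤
        ∫ z in {z | (inner ℝ z (M z) : ℝ) < 0}, fderiv ℝ ψ z ((‖p‖)⁻¹ • M p) := by
  have hsep := hM.separatedBy hn
  have hfin := hsep.isFiniteMeasureOnCompacts
  set E : Set (EuclideanSpace ℝ (Fin n)) := {z | (inner ℝ z (M z) : ℝ) = 0} with hE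
  set A : Set (EuclideanSpace ℝ (Fin n)) := {z | (inner ℝ z (M z) : ℝ) < 0} with hA
  have hp0 : 0 < ‖p‖ := norm_pos_iff.2 hp
  have he : ‖(‖p‖)⁻¹ • M p‖ = 1 := by
    rw [norm_smul, hM.norm_map, norm_inv, norm_norm, inv_mul_cancel₀ hp0.ne']
  obtain ⟨s⟩ := exists_unitSplitting hn ((‖p‖)⁻¹ • M p) he
  set e := (‖p‖)⁻¹ • M p with he'
  obtain ⟨κ, hκK, hκ0, hκ1⟩ : ∃ κ : ℝ, ((Real.sqrt (1 - κ ^ 2))⁻¹) ^ d < 1 + δ ∧ 0 < κ ∧ κ < 1 := by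
    have h1 := (tendsto_inv_sqrt_one_sub_sq_pow d).eventually_lt_const
      (show (1 : ℝ) < 1 + δ by linarith)
    have h2 : ∀ᶠ κ : ℝ in nhdsWithin 0 (Ioi 0), κ ∈ Ioo (0 : ℝ) 1 := Ioo_mem_nhdsGT one_pos
    obtain ⟨κ, h3, h4⟩ := ((h1.filter_mono nhdsWithin_le_nhds).and h2).exists
    exact ⟨κ, h3, h4.1, h4.2⟩
  set U := ball p (κ * ‖p‖) with hU
  refine ⟨U, ball_mem_nhds p (by positivity), fun ψ hψ hc hψ0 hs => ?_⟩
  have hAm : MeasurableSet A := hsep.measurableSet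
  have hf : Integrable (A.indicator fun z => fderiv ℝ ψ z e) :=
    (UnitSplitting.integrable_fderiv_apply hψ hc e).indicator hAm
  -- integrals along lines
  have hline : ∀ y : EuclideanSpace ℝ (Fin d), Isometry fun t : ℝ => s.Q y + t • e := fun y =>
    Isometry.of_dist_eq fun t t' => by
      rw [dist_eq_norm, dist_eq_norm, add_sub_add_left_eq_sub, ← sub_smul, norm_smul, he, mul_one]
  have hgc : ∀ y, HasCompactSupport fun t : ℝ => ψ (s.Q y + t • e) := fun y =>
    hc.comp_isClosedEmbedding (hline y).isClosedEmbedding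
  have hg1 : ∀ y, ContDiff ℝ 1 fun t : ℝ => ψ (s.Q y + t • e) := fun y =>
    hψ.comp (contDiff_const.add (contDiff_id.smul contDiff_const))
  have hzero : ∀ z ∉ U, fderiv ℝ ψ z e = 0 := by
    intro z hz
    have : fderiv ℝ ψ z = 0 := by
      by_contra h
      exact hz (hs (support_fderiv_subset ℝ h))
    rw [this]; rfl
  have hon : ∀ y (t₀ : ℝ), s.Q y + t₀ • e ∈ E ∩ U →
      ∫ t : ℝ, A.indicator (fun z => fderiv ℝ ψ z e) (s.Q y + t • e) = ψ (s.Q y + t₀ • e) := by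
    intro y t₀ ht₀
    rw [← HasCompactSupport.integral_Iic_deriv_eq (hg1 y) (hgc y) t₀,
      integral_Iic_eq_integral_Iio, ← integral_indicator measurableSet_Iio]
    congr 1
    ext t
    rw [indicator_apply, indicator_apply, (s.deriv_slice hψ y t).deriv]
    by_cases htU : s.Q y + t • e ∈ U
    · congr 1
      have hE0 : (inner ℝ (s.Q y + t₀ • e) (M (s.Q y + t₀ • e)) : ℝ) = 0 := ht₀.1
      apply propext
      change (inner ℝ (s.Q y + t • e) (M (s.Q y + t • e)) : ℝ) < 0 ↔ t < t₀
      constructor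
      · intro h
        by_contra! h'
        obtain rfl | h' := h'.eq_or_lt
        · linarith
        · have := hM.quadratic_lt hp hκ1 h' ht₀.2 htU
          linarith
      · intro h
        have := hM.quadratic_lt hp hκ1 h htU ht₀.2
        linarith
    · rw [hzero _ htU]; simp
  have hoff : ∀ y, (∀ t : ℝ, s.Q y + t • e ∉ E ∩ U) →
      ∫ t : ℝ, A.indicator (fun z => fderiv ℝ ψ z e) (s.Q y + t • e) = 0 := by
    intro y hy
    have hI : IsPreconnected {t : ℝ | s.Q y + t • e ∈ U} := by
      have : Convex ℝ {t : ℝ | s.Q y + t • e ∈ U} := by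
        intro a ha b hb u v hu hv huv
        have := convex_ball p (κ * ‖p‖) ha hb hu hv huv
        change s.Q y + (u • a + v • b) • e ∈ U
        convert this using 1
        have : s.Q y = (u + v) • s.Q y := by rw [huv, one_smul]
        conv_lhs => rw [this]
        simp only [smul_eq_mul]
        module
      exact this.isPreconnected
    have hconst : ∀ t t' : ℝ, s.Q y + t • e ∈ U → s.Q y + t' • e ∈ U →
        (s.Q y + t • e ∈ A ↔ s.Q y + t' • e ∈ A) := fun t t' h h' =>
      mem_iff_mem_of_isPreconnected (S := {t : ℝ | s.Q y + t • e ∈ E})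
        (U := {t : ℝ | s.Q y + t • e ∈ A})
        (fun t ht => ((hline y).continuous.tendsto t).eventually (hsep.eventually_mem_iff _ ht))
        hI (disjoint_left.2 fun t h1 h2 => hy t ⟨h2, h1⟩) h h'
    have htot : ∫ t : ℝ, fderiv ℝ ψ (s.Q y + t • e) e = 0 := by
      have h1 := integral_eq_zero_of_hasDerivAt_of_integrable (s.deriv_slice hψ y) ?_ ?_
      · exact h1
      · refine Continuous.integrable_of_hasCompactSupport ?_
          ((hc.fderiv_apply (𝕜 := ℝ) e).comp_isClosedEmbedding (hline y).isClosedEmbedding)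
        exact ((hψ.continuous_fderiv one_ne_zero).clm_apply continuous_const).comp
          (hline y).continuous
      · exact (hg1 y).continuous.integrable_of_hasCompactSupport (hgc y)
    by_cases hA' : ∃ t : ℝ, s.Q y + t • e ∈ U ∩ A
    · obtain ⟨t₀, ht₀U, ht₀A⟩ := hA'
      rw [← htot]
      congr 1
      ext t
      by_cases htU : s.Q y + t • e ∈ U
      · rw [indicator_of_mem ((hconst t t₀ htU ht₀U).2 ht₀A)]
      · rw [indicator_apply, hzero _ htU, ite_self]
    · push Not at hA'
      have : ∀ t : ℝ, A.indicator (fun z => fderiv ℝ ψ z e) (s.Q y + t • e) = 0 := fun t => by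
        by_cases htU : s.Q y + t • e ∈ U
        · exact indicator_of_notMem (fun h => hA' t ⟨htU, h⟩) _
        · rw [indicator_apply, hzero _ htU, ite_self]
      simp [this]
  have hmain := s.setIntegral_le_of_slices (S := E ∩ U) (K := Real.toNNReal (Real.sqrt (1 - κ ^ 2))⁻¹)
    (f := A.indicator fun z => fderiv ℝ ψ z e) (ψ := ψ)
    (hsep.isClosed.measurableSet.inter measurableSet_ball)
    (fun z hz z' hz' => by
      rw [Real.coe_toNNReal _ (by positivity)]
      exact hM.norm_sub_le_of_mem_ball hp hκ0 hκ1 s hz.2 hz'.2 (hz.1.trans hz'.1.symm))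
    hf (fun y => by
      by_cases h : ∃ t : ℝ, s.Q y + t • e ∈ E ∩ U
      · obtain ⟨t, ht⟩ := h
        rw [hon y t ht]; exact hψ0 _
      · push Not at h
        rw [hoff y h]) hψ0
    (IntegrableOn.mono_set (t := E) (hψ.continuous.integrable_of_hasCompactSupport hc)
      inter_subset_left)
    (fun z hz => by
      rw [hon (s.P z) (inner ℝ z e) (by rwa [s.recompose]), s.recompose])
  rw [Real.coe_toNNReal _ (by positivity), integral_indicator hAm] at hmain
  have hEU : ∫ z in E, ψ z ∂μHE[d] = ∫ z in E ∩ U, ψ z ∂μHE[d] := by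
    refine setIntegral_eq_of_subset_of_forall_sdiff_eq_zero (f := ψ) hsep.isClosed.measurableSet
      inter_subset_left fun z hz => ?_
    by_contra h
    exact hz.2 ⟨hz.1, hs (subset_tsupport _ h)⟩
  rw [← hEU] at hmain
  have hI : 0 ≤ ∫ z in E, ψ z ∂μHE[d] := integral_nonneg hψ0
  have hJ : 0 ≤ ∫ z in A, fderiv ℝ ψ z e := by
    rw [← integral_indicator hAm, s.integral_eq hf]
    refine integral_nonneg fun y => ?_
    change 0 ≤ ∫ t : ℝ, A.indicator (fun z => fderiv ℝ ψ z e) (s.Q y + t • e)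
    by_cases h : ∃ t : ℝ, s.Q y + t • e ∈ E ∩ U
    · obtain ⟨t, ht⟩ := h
      rw [hon y t ht]; exact hψ0 _
    · push Not at h
      rw [hoff y h]
  have h1 := hmain.trans (mul_le_mul_of_nonneg_right hκK.le hJ)
  nlinarith [mul_nonneg (sq_nonneg δ) hJ, mul_le_mul_of_nonneg_left h1 (sub_nonneg.2 hδ1.le)]

/-- A field which is normal to the cone has flux through it at least the integral of its norm. -/
lemma setIntegral_norm_le_flux (hn : n = d + 1)
    {ξ : EuclideanSpace ℝ (Fin n) → EuclideanSpace ℝ (Fin n)} (hξ : ContDiff ℝ 1 ξ)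
    (hξM : ∀ z, (inner ℝ z (M z) : ℝ) = 0 → ‖z‖ • ξ z = ‖ξ z‖ • M z) (hξ0 : ξ 0 = 0)
    {θ : EuclideanSpace ℝ (Fin n) → ℝ} (hθ : ContDiff ℝ 1 θ) (hc : HasCompactSupport θ)
    (hθ0 : ∀ z, 0 ≤ θ z) :
    ∫ z in {z | (inner ℝ z (M z) : ℝ) = 0}, θ z * ‖ξ z‖ ∂μHE[d] ≤
      ∫ z in {z | (inner ℝ z (M z) : ℝ) < 0}, divergence (fun z => θ z • ξ z) z := by
  have hsep := hM.separatedBy hn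
  have hfin := hsep.isFiniteMeasureOnCompacts
  set E : Set (EuclideanSpace ℝ (Fin n)) := {z | (inner ℝ z (M z) : ℝ) = 0} with hE
  set A : Set (EuclideanSpace ℝ (Fin n)) := {z | (inner ℝ z (M z) : ℝ) < 0} with hA
  have hmain : -∫ z in A, divergence (fun z => θ z • ξ z) z ≤
      ∫ z in E, θ z * (-‖ξ z‖) ∂μHE[d] := by
    refine le_integral_of_locally_le
      (fun θ => -∫ z in A, divergence (fun z => θ z • ξ z) z) ?_ ?_ hξ.continuous.norm.neg ?_
      hθ hc hθ0
    · simp [divergence]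
    · intro θ φ h1 h2 h3 h4
      simp only [flux_add hξ h1 h2 h3 h4, neg_add]
    · intro ε hε p
      obtain ⟨U, hU, hUψ⟩ := hsep.abs_flux_sub_le hn hξ (half_pos hε) p
      have hV : {z | ‖ξ z‖ < ‖ξ p‖ + ε / 4} ∈ nhds p :=
        hξ.continuous.norm.continuousAt.eventually_lt_const (by linarith)
      -- it suffices to compare with the constant field
      suffices h : ∃ W ∈ nhds p, ∀ ψ : EuclideanSpace ℝ (Fin n) → ℝ, ContDiff ℝ 1 ψ →
          HasCompactSupport ψ → (∀ z, 0 ≤ ψ z) → tsupport ψ ⊆ W →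
          (‖ξ p‖ - ε / 4) * ∫ z in E, ψ z ∂μHE[d] ≤ ∫ z in A, fderiv ℝ ψ z (ξ p) by
        obtain ⟨W, hW, hWψ⟩ := h
        refine ⟨U ∩ ({z | ‖ξ z‖ < ‖ξ p‖ + ε / 4} ∩ W),
          Filter.inter_mem hU (Filter.inter_mem hV hW), fun ψ h1 h2 h3 h4 => ?_⟩
        have b1 := (abs_le.1 (hUψ ψ h1 h2 h3 (h4.trans inter_subset_left))).1
        have b2 := hWψ ψ h1 h2 h3 (h4.trans (inter_subset_right.trans inter_subset_right))
        have b3 : (ε * (3 / 4) - ‖ξ p‖) * ∫ z in E, ψ z ∂μHE[d] ≤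
            ∫ z in E, ψ z * (-‖ξ z‖ + ε) ∂μHE[d] := by
          rw [← integral_const_mul]
          refine integral_mono ((h1.continuous.integrable_of_hasCompactSupport h2).const_mul _)
            ((h1.continuous.mul
              (hξ.continuous.norm.neg.add continuous_const)).integrable_of_hasCompactSupport
                h2.mul_right) fun z => ?_
          by_cases hz : ψ z = 0
          · simp [hz]
          · have h5 : ‖ξ z‖ < ‖ξ p‖ + ε / 4 := (h4 (subset_tsupport _ hz)).2.1
            change _ * ψ z ≤ ψ z * (-‖ξ z‖ + ε)
            nlinarith [h3 z]
        change -∫ z in A, divergence (fun z => ψ z • ξ z) z ≤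
          ∫ z in E, ψ z * (-‖ξ z‖ + ε) ∂μHE[d]
        linarith
      by_cases hp0 : ξ p = 0
      · refine ⟨univ, Filter.univ_mem, fun ψ h1 h2 h3 h4 => ?_⟩
        have : 0 ≤ ∫ z in E, ψ z ∂μHE[d] := integral_nonneg h3
        simp only [hp0, norm_zero, map_zero, integral_zero]
        nlinarith
      by_cases hpE : p ∈ E
      · have hp : p ≠ 0 := fun h => hp0 (h ▸ hξ0)
        have hpn : 0 < ‖p‖ := norm_pos_iff.2 hp
        have hξp : ξ p = ‖ξ p‖ • ((‖p‖)⁻¹ • M p) := by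
          rw [smul_comm, ← hξM p hpE, smul_smul, inv_mul_cancel₀ hpn.ne', one_smul]
        have hξn : 0 < ‖ξ p‖ := norm_pos_iff.2 hp0
        obtain ⟨W, hW, hWψ⟩ := hM.setIntegral_le_flux hn hp
          (δ := min (1 / 2) (ε / 4 / ‖ξ p‖)) (by positivity)
          ((min_le_left _ _).trans_lt (by norm_num))
        refine ⟨W, hW, fun ψ h1 h2 h3 h4 => ?_⟩
        have c1 := hWψ ψ h1 h2 h3 h4
        have c2 : ∀ z, fderiv ℝ ψ z (ξ p) = ‖ξ p‖ * fderiv ℝ ψ z ((‖p‖)⁻¹ • M p) := fun z => by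
          conv_lhs => rw [hξp]
          rw [map_smul, smul_eq_mul]
        simp_rw [c2]
        rw [integral_const_mul]
        have c3 : ‖ξ p‖ - ε / 4 ≤ ‖ξ p‖ * (1 - min (1 / 2) (ε / 4 / ‖ξ p‖)) := by
          have := mul_le_mul_of_nonneg_left (min_le_right (1 / 2) (ε / 4 / ‖ξ p‖)) hξn.le
          rw [mul_div_cancel₀ _ hξn.ne'] at this
          linarith
        have hI : 0 ≤ ∫ z in E, ψ z ∂μHE[d] := integral_nonneg h3
        calc _ ≤ _ := mul_le_mul_of_nonneg_right c3 hI
          _ = ‖ξ p‖ * ((1 - min (1 / 2) (ε / 4 / ‖ξ p‖)) * ∫ z in E, ψ z ∂μHE[d]) := by ring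
          _ ≤ _ := mul_le_mul_of_nonneg_left c1 hξn.le
      · refine ⟨Eᶜ, hsep.isClosed.isOpen_compl.mem_nhds hpE, fun ψ h1 h2 h3 h4 => ?_⟩
        have c1 : ∫ z in E, ψ z ∂μHE[d] = 0 := by
          refine setIntegral_eq_zero_of_forall_eq_zero fun z hz => ?_
          by_contra h
          exact h4 (subset_tsupport _ h) hz
        have c2 := (abs_le.1 (hsep.abs_setIntegral_fderiv_le hn h1 h2 (ξ p))).1
        simp_rw [abs_of_nonneg (h3 _)] at c2
        rw [c1] at c2 ⊢
        linarith
  simp only [mul_neg, integral_neg] at hmain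
  linarith

end IsSymmInvolution

/-- Coordinate projection onto the first `m` coordinates. -/
noncomputable def firstBlock (m n : ℕ) : EuclideanSpace ℝ (Fin n) →L[ℝ] EuclideanSpace ℝ (Fin n) :=
  LinearMap.toContinuousLinearMap
    { toFun := fun z => WithLp.toLp 2 fun i => if (i : ℕ) < m then z i else 0
      map_add' := fun z w => by ext i; by_cases h : (i : ℕ) < m <;> simp [h]
      map_smul' := fun c z => by ext i; by_cases h : (i : ℕ) < m <;> simp [h] }

/-- Coordinate projection onto the coordinates with index at least `m`. -/
noncomputable def lastBlock (m n : ℕ) : EuclideanSpace ℝ (Fin n) →L[ℝ] EuclideanSpace ℝ (Fin n) :=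
  ContinuousLinearMap.id ℝ _ - firstBlock m n

section blocks
variable {m n : ℕ} (z w : EuclideanSpace ℝ (Fin n))

@[simp] lemma firstBlock_apply (i : Fin n) :
    firstBlock m n z i = if (i : ℕ) < m then z i else 0 := rfl

@[simp] lemma lastBlock_apply (i : Fin n) :
    lastBlock m n z i = if (i : ℕ) < m then 0 else z i := by
  by_cases h : (i : ℕ) < m <;> simp [lastBlock, h]

lemma firstBlock_firstBlock : firstBlock m n (firstBlock m n z) = firstBlock m n z := by
  ext i; by_cases h : (i : ℕ) < m <;> simp [h]

lemma firstBlock_lastBlock : firstBlock m n (lastBlock m n z) = 0 := by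
  ext i; by_cases h : (i : ℕ) < m <;> simp [h]

lemma lastBlock_firstBlock : lastBlock m n (firstBlock m n z) = 0 := by
  ext i; by_cases h : (i : ℕ) < m <;> simp [h]

lemma lastBlock_lastBlock : lastBlock m n (lastBlock m n z) = lastBlock m n z := by
  ext i; by_cases h : (i : ℕ) < m <;> simp [h]

lemma inner_firstBlock : (inner ℝ (firstBlock m n z) w : ℝ) = inner ℝ z (firstBlock m n w) := by
  simp only [PiLp.inner_apply]
  refine Finset.sum_congr rfl fun i _ => ?_
  by_cases h : (i : ℕ) < m <;> simp [h]

lemma inner_lastBlock : (inner ℝ (lastBlock m n z) w : ℝ) = inner ℝ z (lastBlock m n w) := by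
  simp only [PiLp.inner_apply]
  refine Finset.sum_congr rfl fun i _ => ?_
  by_cases h : (i : ℕ) < m <;> simp [h]

lemma inner_first_last : (inner ℝ (firstBlock m n z) (lastBlock m n w) : ℝ) = 0 := by
  rw [inner_firstBlock, firstBlock_lastBlock, inner_zero_right]

lemma isSymmInvolution_blocks : IsSymmInvolution (firstBlock m n - lastBlock m n) where
  symm z w := by
    simp only [sub_apply, inner_sub_left, inner_sub_right, inner_firstBlock, inner_lastBlock]
  invol z := by
    simp only [sub_apply, map_sub, firstBlock_firstBlock, firstBlock_lastBlock,
      lastBlock_firstBlock, lastBlock_lastBlock]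
    simp [lastBlock]

lemma inner_blocks : (inner ℝ z ((firstBlock m n - lastBlock m n) z) : ℝ) =
    ‖firstBlock m n z‖ ^ 2 - ‖lastBlock m n z‖ ^ 2 := by
  rw [sub_apply, inner_sub_right, ← real_inner_self_eq_norm_sq, ← real_inner_self_eq_norm_sq,
    inner_firstBlock, inner_lastBlock, firstBlock_firstBlock, lastBlock_lastBlock]

lemma norm_sq_smul_blocks (a b : ℝ) : ‖a • firstBlock m n z - b • lastBlock m n z‖ ^ 2 =
    a ^ 2 * ‖firstBlock m n z‖ ^ 2 + b ^ 2 * ‖lastBlock m n z‖ ^ 2 := by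
  rw [@norm_sub_sq_real, inner_smul_left, inner_smul_right, inner_first_last, norm_smul, norm_smul,
    mul_pow, mul_pow, Real.norm_eq_abs, Real.norm_eq_abs, sq_abs, sq_abs]
  simp

lemma hasFDerivAt_norm_sq_firstBlock :
    HasFDerivAt (fun z => ‖firstBlock m n z‖ ^ 2) ((2 : ℝ) • innerSL ℝ (firstBlock m n z)) z := by
  have h := ((firstBlock m n).hasFDerivAt (x := z)).norm_sq
  refine h.congr_fderiv ?_
  ext v
  simp only [smul_apply, ContinuousLinearMap.comp_apply, innerSL_apply_apply, nsmul_eq_mul]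
  rw [← inner_firstBlock, firstBlock_firstBlock]
  simp

lemma hasFDerivAt_norm_sq_lastBlock :
    HasFDerivAt (fun z => ‖lastBlock m n z‖ ^ 2) ((2 : ℝ) • innerSL ℝ (lastBlock m n z)) z := by
  have h := ((lastBlock m n).hasFDerivAt (x := z)).norm_sq
  refine h.congr_fderiv ?_
  ext v
  simp only [smul_apply, ContinuousLinearMap.comp_apply, innerSL_apply_apply, nsmul_eq_mul]
  rw [← inner_lastBlock, lastBlock_lastBlock]
  simp

lemma divergence_firstBlock (z : EuclideanSpace ℝ (Fin (2 * m))) :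
    divergence (firstBlock m (2 * m)) z = m := by
  simp only [divergence, ContinuousLinearMap.fderiv, firstBlock_apply]
  simp only [PiLp.single_apply, if_true]
  rw [← Finset.sum_filter, Finset.sum_const, Fin.card_filter_val_lt, nsmul_eq_mul, mul_one,
    min_eq_right (by omega)]

lemma divergence_lastBlock (z : EuclideanSpace ℝ (Fin (2 * m))) :
    divergence (lastBlock m (2 * m)) z = m := by
  have h1 : divergence (⇑(firstBlock m (2 * m)) + ⇑(lastBlock m (2 * m))) z = 2 * m := by
    have : ⇑(firstBlock m (2 * m)) + ⇑(lastBlock m (2 * m)) = ContinuousLinearMap.id ℝ _ := by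
      ext z; simp [lastBlock]
    rw [this]
    simp [divergence]
  rw [divergence_add (firstBlock m (2 * m)).differentiableAt
    (lastBlock m (2 * m)).differentiableAt, divergence_firstBlock] at h1
  linarith

end blocks

/-- The regularized calibrating field of the Simons cone. -/
noncomputable def calibration (m : ℕ) (δ : ℝ) (z : EuclideanSpace ℝ (Fin (2 * m))) :
    EuclideanSpace ℝ (Fin (2 * m)) :=
  (Real.sqrt ((‖firstBlock m (2 * m) z‖ ^ 2) ^ 3 + (‖lastBlock m (2 * m) z‖ ^ 2) ^ 3 + δ))⁻¹ •
    (‖firstBlock m (2 * m) z‖ ^ 2 • firstBlock m (2 * m) z -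
      ‖lastBlock m (2 * m) z‖ ^ 2 • lastBlock m (2 * m) z)

section calibration
variable {m : ℕ} {δ : ℝ}

lemma calibration_zero : calibration m δ 0 = 0 := by simp [calibration]

lemma contDiff_calibration (hδ : 0 < δ) : ContDiff ℝ 1 (calibration m δ) := by
  have h1 : ContDiff ℝ 1 fun z => ‖firstBlock m (2 * m) z‖ ^ 2 :=
    (firstBlock m (2 * m)).contDiff.norm_sq ℝ
  have h2 : ContDiff ℝ 1 fun z => ‖lastBlock m (2 * m) z‖ ^ 2 :=
    (lastBlock m (2 * m)).contDiff.norm_sq ℝ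
  have hN : ∀ z, 0 < (‖firstBlock m (2 * m) z‖ ^ 2) ^ 3 + (‖lastBlock m (2 * m) z‖ ^ 2) ^ 3 + δ :=
    fun z => by positivity
  exact ((((h1.pow 3).add (h2.pow 3)).add contDiff_const).sqrt (fun z => (hN z).ne')).inv
    (fun z => (Real.sqrt_pos.2 (hN z)).ne') |>.smul
      ((h1.smul (firstBlock m (2 * m)).contDiff).sub (h2.smul (lastBlock m (2 * m)).contDiff))

lemma norm_sq_calibration (hδ : 0 < δ) (z : EuclideanSpace ℝ (Fin (2 * m))) :
    ‖calibration m δ z‖ ^ 2 =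
      ((‖firstBlock m (2 * m) z‖ ^ 2) ^ 3 + (‖lastBlock m (2 * m) z‖ ^ 2) ^ 3) /
      ((‖firstBlock m (2 * m) z‖ ^ 2) ^ 3 + (‖lastBlock m (2 * m) z‖ ^ 2) ^ 3 + δ) := by
  rw [calibration, norm_smul, mul_pow, norm_sq_smul_blocks, norm_inv, inv_pow, Real.norm_eq_abs,
    sq_abs, Real.sq_sqrt (by positivity)]
  field_simp

lemma norm_calibration_le_one (hδ : 0 < δ) (z : EuclideanSpace ℝ (Fin (2 * m))) :
    ‖calibration m δ z‖ ≤ 1 := by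
  refine le_of_sq_le_sq ?_ zero_le_one
  rw [norm_sq_calibration hδ, one_pow]
  exact div_le_one_of_le₀ (by linarith) (by positivity)

lemma norm_smul_calibration (z : EuclideanSpace ℝ (Fin (2 * m)))
    (hz : (inner ℝ z ((firstBlock m (2 * m) - lastBlock m (2 * m)) z) : ℝ) = 0) :
    ‖z‖ • calibration m δ z =
      ‖calibration m δ z‖ • (firstBlock m (2 * m) - lastBlock m (2 * m)) z := by
  rw [inner_blocks, sub_eq_zero] at hz
  have h : calibration m δ z = ((Real.sqrt ((‖firstBlock m (2 * m) z‖ ^ 2) ^ 3 +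
      (‖lastBlock m (2 * m) z‖ ^ 2) ^ 3 + δ))⁻¹ * ‖firstBlock m (2 * m) z‖ ^ 2) •
        (firstBlock m (2 * m) - lastBlock m (2 * m)) z := by
    rw [calibration, ← hz, ← smul_sub, smul_smul]; rfl
  rw [h, norm_smul, isSymmInvolution_blocks.norm_map, Real.norm_eq_abs, abs_of_nonneg (by positivity),
    smul_smul, mul_comm ‖z‖]

lemma tendsto_norm_calibration {z : EuclideanSpace ℝ (Fin (2 * m))} (hz : z ≠ 0) :
    Filter.Tendsto (fun k : ℕ => ‖calibration m (1 / ((k : ℝ) + 1)) z‖) Filter.atTop (nhds 1) := by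
  have h0 : 0 < (‖firstBlock m (2 * m) z‖ ^ 2) ^ 3 + (‖lastBlock m (2 * m) z‖ ^ 2) ^ 3 := by
    by_cases h : firstBlock m (2 * m) z = 0
    · have : lastBlock m (2 * m) z ≠ 0 := by simpa [lastBlock, h] using hz
      have := norm_pos_iff.2 this
      positivity
    · have := norm_pos_iff.2 h
      positivity
  set c := (‖firstBlock m (2 * m) z‖ ^ 2) ^ 3 + (‖lastBlock m (2 * m) z‖ ^ 2) ^ 3 with hc
  have h1 : ∀ k : ℕ, ‖calibration m (1 / ((k : ℝ) + 1)) z‖ =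
      Real.sqrt (c / (c + 1 / ((k : ℝ) + 1))) := fun k => by
    rw [hc, ← norm_sq_calibration (by positivity), Real.sqrt_sq (norm_nonneg _)]
  simp_rw [h1]
  have h2 : Filter.Tendsto (fun k : ℕ => c / (c + 1 / ((k : ℝ) + 1))) Filter.atTop
      (nhds (c / (c + 0))) :=
    tendsto_const_nhds.div (tendsto_const_nhds.add tendsto_one_div_add_atTop_nhds_zero_nat)
      (by simpa using h0.ne')
  rw [add_zero, div_self h0.ne'] at h2
  simpa using h2.sqrt

lemma bracket_nonneg {a X Y : ℝ} (ha : 4 ≤ a) (hX : 0 ≤ X) (hY : 0 ≤ Y) (hδ : 0 < δ) :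
    0 ≤ (a + 2) * (X ^ 3 + Y ^ 3 + δ) - 3 * (X + Y) * (X ^ 2 + Y ^ 2) := by
  have h : (a + 2) * (X ^ 3 + Y ^ 3 + δ) - 3 * (X + Y) * (X ^ 2 + Y ^ 2) =
      (a + 2) * δ + (X + Y) * ((a - 4) * (X ^ 2 - X * Y + Y ^ 2) + 3 * (X - Y) ^ 2) := by ring
  rw [h]
  have : 0 ≤ X ^ 2 - X * Y + Y ^ 2 := by nlinarith [sq_nonneg (X - Y)]
  have : 0 ≤ a - 4 := by linarith
  positivity

lemma divergence_calibration (hδ : 0 < δ) (z : EuclideanSpace ℝ (Fin (2 * m))) :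
    ∃ c : ℝ, 0 < c ∧ divergence (calibration m δ) z =
      c * ((m + 2) * (‖firstBlock m (2 * m) z‖ ^ 2 - ‖lastBlock m (2 * m) z‖ ^ 2) *
        ((‖firstBlock m (2 * m) z‖ ^ 2) ^ 3 + (‖lastBlock m (2 * m) z‖ ^ 2) ^ 3 + δ) -
        3 * ((‖firstBlock m (2 * m) z‖ ^ 2) ^ 4 - (‖lastBlock m (2 * m) z‖ ^ 2) ^ 4)) := by
  have hX := hasFDerivAt_norm_sq_firstBlock (m := m) z
  have hY := hasFDerivAt_norm_sq_lastBlock (m := m) z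
  have hdX := hX.fderiv
  have hdY := hY.neg.fderiv
  have hN0 : 0 < (‖firstBlock m (2 * m) z‖ ^ 2) ^ 3 + (‖lastBlock m (2 * m) z‖ ^ 2) ^ 3 + δ := by
    positivity
  have hS0 := Real.sqrt_pos.2 hN0
  have hSN := Real.sq_sqrt hN0.le
  have hs := ((Real.hasDerivAt_sqrt hN0.ne').inv hS0.ne').comp_hasFDerivAt z
    (((hX.pow 3).add (hY.pow 3)).add_const δ)
  have hcal : calibration m δ = fun z =>
      (Real.sqrt ((‖firstBlock m (2 * m) z‖ ^ 2) ^ 3 + (‖lastBlock m (2 * m) z‖ ^ 2) ^ 3 + δ))⁻¹ •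
        (((fun z => ‖firstBlock m (2 * m) z‖ ^ 2 • firstBlock m (2 * m) z) +
          fun z => (-‖lastBlock m (2 * m) z‖ ^ 2) • lastBlock m (2 * m) z) z) := by
    ext z : 1
    simp [calibration, sub_eq_add_neg]
  have d1 := hX.differentiableAt.smul (firstBlock m (2 * m)).differentiableAt
  have d2 := hY.neg.differentiableAt.smul (lastBlock m (2 * m)).differentiableAt
  have i1 : (inner ℝ (lastBlock m (2 * m) z) (firstBlock m (2 * m) z) : ℝ) = 0 := by
    rw [real_inner_comm, inner_first_last]
  refine ⟨(Real.sqrt ((‖firstBlock m (2 * m) z‖ ^ 2) ^ 3 +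
    (‖lastBlock m (2 * m) z‖ ^ 2) ^ 3 + δ) ^ 3)⁻¹, by positivity, ?_⟩
  have e1 : divergence (fun z => ‖firstBlock m (2 * m) z‖ ^ 2 • firstBlock m (2 * m) z) z =
      (m + 2) * ‖firstBlock m (2 * m) z‖ ^ 2 := by
    rw [divergence_smul hX.differentiableAt (firstBlock m (2 * m)).differentiableAt, hdX,
      divergence_firstBlock, smul_apply, innerSL_apply_apply, real_inner_self_eq_norm_sq,
      smul_eq_mul]
    ring
  have e2 : divergence (fun z => (-‖lastBlock m (2 * m) z‖ ^ 2) • lastBlock m (2 * m) z) z =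
      -(m + 2) * ‖lastBlock m (2 * m) z‖ ^ 2 := by
    refine (divergence_smul hY.neg.differentiableAt
      (lastBlock m (2 * m)).differentiableAt).trans ?_
    rw [hdY, divergence_lastBlock, neg_apply, smul_apply, innerSL_apply_apply,
      real_inner_self_eq_norm_sq, smul_eq_mul, Pi.neg_apply]
    ring
  have hdiv := divergence_smul hs.differentiableAt (d1.add d2)
  rw [hs.fderiv, divergence_add d1 d2] at hdiv
  rw [hcal]
  refine hdiv.trans ?_
  rw [show divergence ((fun z => ‖firstBlock m (2 * m) z‖ ^ 2) • ⇑(firstBlock m (2 * m))) z = _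
    from e1, show divergence ((-fun z => ‖lastBlock m (2 * m) z‖ ^ 2) • ⇑(lastBlock m (2 * m))) z = _
    from e2]
  simp only [Pi.add_apply, Pi.smul_apply', Pi.neg_apply, smul_apply, add_apply, map_add, map_smul,
    innerSL_apply_apply, i1, inner_first_last, real_inner_self_eq_norm_sq,
    smul_eq_mul, nsmul_eq_mul, Function.comp_apply, Pi.inv_apply]
  set X := ‖firstBlock m (2 * m) z‖ ^ 2
  set Y := ‖lastBlock m (2 * m) z‖ ^ 2
  set S := Real.sqrt (X ^ 3 + Y ^ 3 + δ)
  rw [← hSN]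
  field_simp
  push_cast
  ring

/-- The divergence of the calibration has the sign of the quadratic form defining the cone. -/
lemma divergence_calibration_nonneg (hm : 4 ≤ m) (hδ : 0 < δ) {z : EuclideanSpace ℝ (Fin (2 * m))}
    (hz : 0 ≤ (inner ℝ z ((firstBlock m (2 * m) - lastBlock m (2 * m)) z) : ℝ)) :
    0 ≤ divergence (calibration m δ) z := by
  obtain ⟨c, hc, h⟩ := divergence_calibration hδ z
  have hb := bracket_nonneg (a := m) (by exact_mod_cast hm) (sq_nonneg ‖firstBlock m (2 * m) z‖)
    (sq_nonneg ‖lastBlock m (2 * m) z‖) hδ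
  rw [inner_blocks] at hz
  rw [h]
  exact mul_nonneg hc.le ((mul_nonneg hz hb).trans_eq (by ring))

lemma divergence_calibration_nonpos (hm : 4 ≤ m) (hδ : 0 < δ) {z : EuclideanSpace ℝ (Fin (2 * m))}
    (hz : (inner ℝ z ((firstBlock m (2 * m) - lastBlock m (2 * m)) z) : ℝ) ≤ 0) :
    divergence (calibration m δ) z ≤ 0 := by
  obtain ⟨c, hc, h⟩ := divergence_calibration hδ z
  have hb := bracket_nonneg (a := m) (by exact_mod_cast hm) (sq_nonneg ‖firstBlock m (2 * m) z‖)
    (sq_nonneg ‖lastBlock m (2 * m) z‖) hδ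
  rw [inner_blocks] at hz
  rw [h]
  exact mul_nonpos_of_nonneg_of_nonpos hc.le
    (Eq.trans_le (by ring) (mul_nonpos_of_nonpos_of_nonneg hz hb))

end calibration

section det
variable {n : ℕ}

/-- The determinant as a fixed linear combination of determinants of shifted operators. -/
lemma exists_det_eq_sum_shift (n : ℕ) (c : ℝ) : ∃ l : Fin (n + 1) → ℝ,
    ∀ L : EuclideanSpace ℝ (Fin n) →L[ℝ] EuclideanSpace ℝ (Fin n), L.det = ∑ i, l i *
      ((c + (i : ℕ) + 1 : ℝ) • ContinuousLinearMap.id ℝ (EuclideanSpace ℝ (Fin n)) + L).det := by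
  let v : Fin (n + 1) → ℝ := fun i => c + (i : ℕ) + 1
  refine ⟨fun i => (Lagrange.basis Finset.univ v i).eval 0, fun L => ?_⟩
  have hv : InjOn v (Finset.univ : Finset (Fin (n + 1))) := by
    intro i _ j _ h
    simp only [v] at h
    exact Fin.ext (by exact_mod_cast (by linarith : ((i : ℕ) : ℝ) = (j : ℕ)))
  let p := (-(L : EuclideanSpace ℝ (Fin n) →ₗ[ℝ] EuclideanSpace ℝ (Fin n))).charpoly
  have hp : ∀ t : ℝ, p.eval t = (t • ContinuousLinearMap.id ℝ (EuclideanSpace ℝ (Fin n)) + L).det := fun t => by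
    rw [LinearMap.eval_charpoly, ContinuousLinearMap.det]
    congr 1
    ext x i
    simp [Algebra.algebraMap_eq_smul_one]
  have hdeg : p.degree < (Finset.univ : Finset (Fin (n + 1))).card := by
    rw [Polynomial.degree_eq_natDegree (LinearMap.charpoly_monic _).ne_zero,
      LinearMap.charpoly_natDegree]
    simp only [finrank_euclideanSpace, Fintype.card_fin, Finset.card_univ]
    exact_mod_cast Nat.lt_succ_self n
  have h := congrArg (Polynomial.eval 0) (Lagrange.eq_interpolate hv hdeg)
  rw [hp, Lagrange.interpolate_apply, Polynomial.eval_finsetSum,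
    show (0 : ℝ) • ContinuousLinearMap.id ℝ (EuclideanSpace ℝ (Fin n)) = 0 from
      zero_smul ℝ (ContinuousLinearMap.id ℝ (EuclideanSpace ℝ (Fin n))),
    zero_add] at h
  simp only [Polynomial.eval_mul, Polynomial.eval_C, hp] at h
  rw [h]
  exact Finset.sum_congr rfl fun i _ => mul_comm _ _

lemma det_smul_id_add_pos {L : EuclideanSpace ℝ (Fin n) →L[ℝ] EuclideanSpace ℝ (Fin n)} {s : ℝ} (hs : ‖L‖ < s) :
    0 < (s • ContinuousLinearMap.id ℝ (EuclideanSpace ℝ (Fin n)) + L).det := by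
  have hs0 : 0 < s := (norm_nonneg _).trans_lt hs
  have hne : ∀ t ∈ Icc (0 : ℝ) 1, (s • ContinuousLinearMap.id ℝ (EuclideanSpace ℝ (Fin n)) + t • L).det ≠ 0 := by
    intro t ht h0
    obtain ⟨x, hx, hx0⟩ := Submodule.exists_mem_ne_zero_of_ne_bot
      (LinearMap.bot_lt_ker_of_det_eq_zero h0).ne'
    have h1 : s • x + t • L x = 0 := by simpa using hx
    have h2 : ‖s • x‖ = ‖t • L x‖ := by rw [eq_neg_of_add_eq_zero_left h1, norm_neg]
    rw [norm_smul, norm_smul, Real.norm_of_nonneg hs0.le, Real.norm_of_nonneg ht.1] at h2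
    have h3 : t * ‖L x‖ ≤ 1 * (‖L‖ * ‖x‖) :=
      mul_le_mul ht.2 (L.le_opNorm x) (norm_nonneg _) zero_le_one
    have : ‖L‖ * ‖x‖ < s * ‖x‖ := mul_lt_mul_of_pos_right hs (norm_pos_iff.2 hx0)
    linarith
  have hc : Continuous fun t : ℝ => (s • ContinuousLinearMap.id ℝ (EuclideanSpace ℝ (Fin n)) + t • L).det :=
    ContinuousLinearMap.continuous_det.comp (by fun_prop)
  by_contra hneg
  have h0 : 0 < (s • ContinuousLinearMap.id ℝ (EuclideanSpace ℝ (Fin n)) + (0 : ℝ) • L).det := by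
    have : (s • ContinuousLinearMap.id ℝ (EuclideanSpace ℝ (Fin n)) + (0 : ℝ) • L).det = s ^ n := by
      rw [show (0 : ℝ) • L = 0 from zero_smul ℝ L, add_zero, ContinuousLinearMap.det]
      simp
    rw [this]; positivity
  obtain ⟨t, ht, h⟩ := intermediate_value_Icc' (zero_le_one' ℝ) hc.continuousOn
    (show (0 : ℝ) ∈ _ from ⟨by simpa using hneg, h0.le⟩)
  exact hne t ht h

variable {K : ℝ≥0} {g g₀ g₁ : EuclideanSpace ℝ (Fin n) → EuclideanSpace ℝ (Fin n)} {s : ℝ} {T : Set (EuclideanSpace ℝ (Fin n))}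

lemma bijective_smul_add_of_lipschitz (hg : LipschitzWith K g) (hs : K < s) :
    Function.Bijective fun x => s • x + g x := by
  have hs0 : 0 < s := K.2.trans_lt hs
  constructor
  · intro x y h
    by_contra hne
    have h1 : s • (x - y) = g y - g x := by
      rw [smul_sub]
      simp only at h
      rw [sub_eq_sub_iff_add_eq_add, h, add_comm]
    have h2 := hg.dist_le_mul y x
    rw [dist_eq_norm, ← h1, norm_smul, Real.norm_of_nonneg hs0.le, dist_comm, dist_eq_norm] at h2
    have := mul_lt_mul_of_pos_right hs (norm_pos_iff.2 (sub_ne_zero.2 hne))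
    linarith
  · intro y
    have hc : ContractingWith (K / s.toNNReal) fun x => s⁻¹ • (y - g x) := by
      refine ⟨?_, LipschitzWith.of_dist_le_mul fun a b => ?_⟩
      · rw [div_lt_one (by simpa using hs0)]
        exact Real.lt_toNNReal_iff_coe_lt.2 hs
      · have := hg.dist_le_mul b a
        rw [dist_eq_norm, ← smul_sub, norm_smul, sub_sub_sub_cancel_left, ← dist_eq_norm,
          Real.norm_of_nonneg (by positivity)]
        rw [dist_comm b a] at this
        simp only [NNReal.coe_div, Real.coe_toNNReal s hs0.le]
        calc _ ≤ s⁻¹ * (K * dist a b) := by gcongr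
          _ = _ := by ring
    refine ⟨ContractingWith.fixedPoint _ hc, ?_⟩
    have h := hc.fixedPoint_isFixedPt
    rw [Function.IsFixedPt] at h
    set x := ContractingWith.fixedPoint _ hc
    have h2 : s • x = y - g x := by
      conv_lhs => rw [← h]
      rw [smul_inv_smul₀ hs0.ne']
    exact (congrArg (· + g x) h2).trans (sub_add_cancel y (g x))

lemma integrableOn_det_fderiv (hg : LipschitzWith K g) (hT : volume T < ⊤) (s : ℝ) :
    IntegrableOn (fun x => (s • ContinuousLinearMap.id ℝ (EuclideanSpace ℝ (Fin n)) + fderiv ℝ g x).det) T := by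
  obtain ⟨C, hC⟩ := ((isCompact_closedBall (0 : EuclideanSpace ℝ (Fin n) →L[ℝ] EuclideanSpace ℝ (Fin n)) (K : ℝ)).image
    (ContinuousLinearMap.continuous_det.comp
      (continuous_const.add continuous_id : Continuous fun L : EuclideanSpace ℝ (Fin n) →L[ℝ] EuclideanSpace ℝ (Fin n) =>
        s • ContinuousLinearMap.id ℝ (EuclideanSpace ℝ (Fin n)) + L))).isBounded.exists_norm_le
  refine Measure.integrableOn_of_bounded (M := C) hT.ne ?_ ?_
  · refine Measurable.aestronglyMeasurable ?_
    exact ContinuousLinearMap.continuous_det.measurable.comp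
      (measurable_const.add (measurable_fderiv ℝ g))
  · refine Filter.Eventually.of_forall fun x => hC _ ⟨fderiv ℝ g x, ?_, rfl⟩
    simpa using norm_fderiv_le_of_lipschitz ℝ hg (x₀ := x)

lemma volume_image_eq_zero_of_lipschitz (hg : LipschitzWith K g) (hT : volume T = 0) :
    volume (g '' T) = 0 := by
  have h := euclideanHausdorffMeasure_image_le_of_lipschitzOnWith (hg.lipschitzOnWith (s := T)) n
  rw [EuclideanSpace.euclideanHausdorffMeasure_eq_volume, hT, mul_zero] at h
  exact le_antisymm h bot_le

lemma setIntegral_det_smul_id_add (hg : LipschitzWith K g) (hs : K < s) (hT : MeasurableSet T) :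
    ∫ x in T, (s • ContinuousLinearMap.id ℝ (EuclideanSpace ℝ (Fin n)) + fderiv ℝ g x).det =
      (volume ((fun x => s • x + g x) '' T)).toReal := by
  set h : EuclideanSpace ℝ (Fin n) → EuclideanSpace ℝ (Fin n) := fun x => s • x + g x with hh
  have hs0 : 0 < s := K.2.trans_lt hs
  have hL : LipschitzWith (s.toNNReal + K) h := by
    refine LipschitzWith.add (LipschitzWith.of_dist_le_mul fun a b => ?_) hg
    rw [dist_eq_norm, ← smul_sub, norm_smul, Real.norm_of_nonneg hs0.le, dist_eq_norm,
      Real.coe_toNNReal s hs0.le]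
  set D := {x | DifferentiableAt ℝ g x}
  have hD : MeasurableSet D := measurableSet_of_differentiableAt ℝ g
  have hD0 : volume Dᶜ = 0 := hg.ae_differentiableAt
  have hpos : ∀ x, 0 < (s • ContinuousLinearMap.id ℝ (EuclideanSpace ℝ (Fin n)) + fderiv ℝ g x).det := fun x =>
    det_smul_id_add_pos ((norm_fderiv_le_of_lipschitz ℝ hg).trans_lt hs)
  have himg : volume (h '' T) = volume (h '' (T ∩ D)) := by
    refine le_antisymm ?_ (measure_mono (image_mono inter_subset_left))
    calc volume (h '' T) = volume (h '' (T ∩ D) ∪ h '' (T ∩ Dᶜ)) := by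
          rw [← image_union, inter_union_compl]
      _ ≤ volume (h '' (T ∩ D)) + volume (h '' (T ∩ Dᶜ)) := measure_union_le _ _
      _ = volume (h '' (T ∩ D)) := by
          rw [volume_image_eq_zero_of_lipschitz hL (measure_mono_null inter_subset_right hD0),
            add_zero]
  have hTD : (T ∩ D : Set (EuclideanSpace ℝ (Fin n))) =ᵐ[volume] T := inter_ae_eq_left_of_ae_eq_univ (ae_eq_univ.2 hD0)
  rw [himg, ← lintegral_abs_det_fderiv_eq_addHaar_image volume (hT.inter hD) (f := h)
    (f' := fun x => s • ContinuousLinearMap.id ℝ (EuclideanSpace ℝ (Fin n)) + fderiv ℝ g x) (fun x hx =>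
      (((hasFDerivAt_id x).const_smul s).add hx.2.hasFDerivAt).hasFDerivWithinAt)
    (bijective_smul_add_of_lipschitz hg hs).injective.injOn, setLIntegral_congr hTD,
    ← integral_toReal]
  · refine integral_congr_ae (Filter.Eventually.of_forall fun x => ?_)
    simp only
    rw [abs_of_pos (hpos x), ENNReal.toReal_ofReal (hpos x).le]
  · refine Measurable.aemeasurable ?_
    exact (ContinuousLinearMap.continuous_det.measurable.comp
      (measurable_const.add (measurable_fderiv ℝ g))).abs.ennreal_ofReal
  · exact Filter.Eventually.of_forall fun x => ENNReal.ofReal_lt_top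

/-- The integral of the Jacobian determinant only depends on the values outside the domain of
integration. -/
lemma setIntegral_det_fderiv_congr {K₀ K₁ : ℝ≥0} (h₀ : LipschitzWith K₀ g₀)
    (h₁ : LipschitzWith K₁ g₁) (hT : MeasurableSet T) (hTv : volume T < ⊤)
    (h : EqOn g₀ g₁ Tᶜ) :
    ∫ x in T, (fderiv ℝ g₀ x).det = ∫ x in T, (fderiv ℝ g₁ x).det := by
  set K := max K₀ K₁
  replace h₀ := h₀.weaken (le_max_left K₀ K₁)
  replace h₁ := h₁.weaken (le_max_right K₀ K₁)
  have himage : ∀ {s : ℝ}, K < s →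
      (fun x => s • x + g₀ x) '' T = (fun x => s • x + g₁ x) '' T := fun {s} hs => by
    rw [← compl_inj_iff, ← image_compl_eq (bijective_smul_add_of_lipschitz h₀ hs),
      ← image_compl_eq (bijective_smul_add_of_lipschitz h₁ hs)]
    exact image_congr fun x hx => by rw [h hx]
  obtain ⟨l, hl⟩ := exists_det_eq_sum_shift n K
  simp_rw [hl (fderiv ℝ _ _)]
  rw [integral_finsetSum _ fun i _ => (integrableOn_det_fderiv h₀ hTv _).const_mul _,
    integral_finsetSum _ fun i _ => (integrableOn_det_fderiv h₁ hTv _).const_mul _]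
  refine Finset.sum_congr rfl fun i _ => ?_
  have hi : (K : ℝ) < K + (i : ℕ) + 1 := by
    have : (0 : ℝ) ≤ (i : ℕ) := by positivity
    linarith
  rw [integral_const_mul, integral_const_mul, setIntegral_det_smul_id_add h₀ hi hT,
    setIntegral_det_smul_id_add h₁ hi hT, himage hi]

end det

/-- Radial retraction onto the closed ball of radius `ε` around the origin. -/
noncomputable def clamp {E : Type*} [NormedAddCommGroup E] [NormedSpace ℝ E] (ε : ℝ) (y : E) : E :=
  (ε / max ε ‖y‖) • y

section clamp
variable {E : Type*} [NormedAddCommGroup E] [NormedSpace ℝ E] {ε : ℝ} {y : E}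

lemma clamp_of_norm_le (hε : 0 < ε) (hy : ‖y‖ ≤ ε) : clamp ε y = y := by
  rw [clamp, max_eq_left hy, div_self hε.ne', one_smul]

lemma norm_clamp_of_le_norm (hε : 0 < ε) (hy : ε ≤ ‖y‖) : ‖clamp ε y‖ = ε := by
  have : 0 < ‖y‖ := hε.trans_le hy
  rw [clamp, max_eq_right hy, norm_smul, Real.norm_of_nonneg (by positivity)]
  field_simp

lemma lipschitzWith_clamp (hε : 0 < ε) : LipschitzWith 2 (clamp ε : E → E) := by
  refine LipschitzWith.of_dist_le_mul fun x y => ?_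
  rw [dist_eq_norm, dist_eq_norm]
  set a := max ε ‖x‖ with ha
  set b := max ε ‖y‖ with hb
  have ha0 : 0 < a := hε.trans_le (le_max_left _ _)
  have hb0 : 0 < b := hε.trans_le (le_max_left _ _)
  have hab : |b - a| ≤ ‖x - y‖ := by
    rw [norm_sub_rev, ha, hb, max_comm ε, max_comm ε]
    refine (abs_max_sub_max_le_abs ‖y‖ ‖x‖ ε).trans ?_
    exact abs_norm_sub_norm_le y x
  have e : clamp ε x - clamp ε y = (ε / a) • (x - y) + ((ε / a) * ((b - a) / b)) • y := by
    rw [clamp, clamp, ← ha, ← hb]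
    have : ε / a * ((b - a) / b) = ε / a - ε / b := by field_simp
    rw [this, smul_sub, sub_smul]
    abel
  have h1 : ε / a ≤ 1 := (div_le_one ha0).2 (le_max_left _ _)
  have h2 : ‖y‖ / b ≤ 1 := (div_le_one hb0).2 (le_max_right _ _)
  rw [e]
  calc _ ≤ ‖(ε / a) • (x - y)‖ + ‖((ε / a) * ((b - a) / b)) • y‖ := norm_add_le _ _
    _ = (ε / a) * ‖x - y‖ + (ε / a) * (|b - a| * (‖y‖ / b)) := by
        rw [norm_smul, norm_smul, norm_mul, norm_div (b - a), Real.norm_of_nonneg (by positivity),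
          Real.norm_of_nonneg hb0.le, Real.norm_eq_abs]
        ring
    _ ≤ 1 * ‖x - y‖ + 1 * (‖x - y‖ * 1) := by gcongr
    _ = _ := by simp; ring

end clamp

section degree
variable {n : ℕ} {f : EuclideanSpace ℝ (Fin n) → EuclideanSpace ℝ (Fin n)}
  {A E : Set (EuclideanSpace ℝ (Fin n))} {ε R : ℝ} {K : ℝ≥0}

lemma det_fderiv_clamp_eq_zero (hf : Continuous f) (hε : 0 < ε) {x z : EuclideanSpace ℝ (Fin n)}
    (hx : ε < ‖f x - z‖) : (fderiv ℝ (fun x => clamp ε (f x - z)) x).det = 0 := by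
  set g := fun x => clamp ε (f x - z)
  have hg : ∀ᶠ x' in nhds x, ‖g x'‖ ^ 2 = ε ^ 2 := by
    have : ∀ᶠ x' in nhds x, ε < ‖f x' - z‖ :=
      (hf.sub continuous_const).norm.continuousAt.eventually (lt_mem_nhds hx)
    filter_upwards [this] with x' hx'
    rw [norm_clamp_of_le_norm hε hx'.le]
  have horth : ∀ v, (inner ℝ (g x) (fderiv ℝ g x v) : ℝ) = 0 := fun v => by
    by_cases hd : DifferentiableAt ℝ g x
    · have h1 := hd.hasFDerivAt.norm_sq
      have h2 := h1.unique ((hasFDerivAt_const (ε ^ 2) x).congr_of_eventuallyEq hg)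
      have h3 := DFunLike.congr_fun h2 v
      simpa using h3
    · rw [fderiv_zero_of_not_differentiableAt hd]; simp
  by_contra hdet
  obtain ⟨v, hv⟩ := (ContinuousLinearMap.toContinuousLinearEquivOfDetNeZero _ hdet).surjective (g x)
  have h0 : (inner ℝ (g x) (g x) : ℝ) = 0 := by
    conv_lhs => rw [← hv]
    have := horth v
    rwa [← hv] at this
  rw [real_inner_self_eq_norm_sq, hg.self_of_nhds] at h0
  exact hε.ne' (pow_eq_zero_iff (two_ne_zero)|>.1 h0)

/-- The volume of the ball of radius `ε` around `z`, counted with the degree of `f` on `A`. -/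
noncomputable def degreeVolume (f : EuclideanSpace ℝ (Fin n) → EuclideanSpace ℝ (Fin n))
    (A : Set (EuclideanSpace ℝ (Fin n))) (ε : ℝ) (z : EuclideanSpace ℝ (Fin n)) : ℝ :=
  ∫ x in A, (fderiv ℝ (fun x => clamp ε (f x - z)) x).det

lemma isCompact_preimage_of_eq_id (hf : Continuous f) (hid : ∀ x, R ≤ ‖x‖ → f x = x)
    {s : Set (EuclideanSpace ℝ (Fin n))} (hs : IsCompact s) : IsCompact (f ⁻¹' s) := by
  refine ((isCompact_closedBall 0 R).union hs).of_isClosed_subset (hs.isClosed.preimage hf) ?_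
  intro x hx
  rcases le_total R ‖x‖ with h | h
  · right; rwa [mem_preimage, hid x h] at hx
  · left; simpa using h

lemma degreeVolume_eq (hf : LipschitzWith K f) (hid : ∀ x, R ≤ ‖x‖ → f x = x) (hA : IsOpen A)
    (hAE : IsClosed (A ∪ E)) {z₀ z : EuclideanSpace ℝ (Fin n)} {r : ℝ}
    (hE : ∀ x ∈ E, 2 * r < ‖f x - z₀‖) (hε : 0 < ε) (hεr : ε < r) (hz : ‖z - z₀‖ < r) :
    degreeVolume f A ε z = degreeVolume f A ε z₀ := by
  set C := A ∩ f ⁻¹' closedBall z₀ (2 * r) with hC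
  have hCc : IsCompact C := by
    have : C = (A ∪ E) ∩ f ⁻¹' closedBall z₀ (2 * r) := by
      ext x
      simp only [hC, mem_inter_iff, mem_union, mem_preimage, mem_closedBall, dist_eq_norm]
      have := hE x
      constructor
      · tauto
      · rintro ⟨h | h, h'⟩
        · exact ⟨h, h'⟩
        · exact absurd (this h) h'.not_gt
    rw [this]
    exact (isCompact_preimage_of_eq_id hf.continuous hid (isCompact_closedBall _ _)).inter_left hAE
  obtain ⟨δ, hδ, hδA⟩ := hCc.exists_cthickening_subset_open hA inter_subset_left
  set T := cthickening δ C
  have hTc : IsCompact T := hCc.cthickening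
  set χ : EuclideanSpace ℝ (Fin n) → ℝ := fun x => (thickenedIndicator hδ C x : ℝ)
  have hχ1 : ∀ x ∈ C, χ x = 1 := fun x hx => by
    simp only [χ, thickenedIndicator_one hδ C hx, NNReal.coe_one]
  have hχ0 : ∀ x ∉ T, χ x = 0 := fun x hx => by
    simp only [χ, thickenedIndicator_zero hδ C fun h => hx (thickening_subset_cthickening δ C h),
      NNReal.coe_zero]
  have hχle : ∀ x, χ x ≤ 1 := fun x => by exact_mod_cast thickenedIndicator_le_one hδ C x
  have hχnn : ∀ x, 0 ≤ χ x := fun x => NNReal.coe_nonneg _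
  have hχL : LipschitzWith (δ.toNNReal⁻¹) χ := lipschitzWith_thickenedIndicator hδ C
  set h : EuclideanSpace ℝ (Fin n) → EuclideanSpace ℝ (Fin n) := fun x => f x - χ x • (z - z₀)
  have hhL : ∃ K', LipschitzWith K' h :=
    ⟨_, hf.sub (((ContinuousLinearMap.toSpanSingleton ℝ (z - z₀)).lipschitz).comp hχL)⟩
  obtain ⟨K', hhL⟩ := hhL
  have hTA : ∀ {g : EuclideanSpace ℝ (Fin n) → ℝ}, (∀ x ∈ A \ T, g x = 0) →
      ∫ x in A, g x = ∫ x in T, g x :=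
    setIntegral_eq_of_subset_of_forall_sdiff_eq_zero hA.measurableSet hδA
  have hout : ∀ x ∈ A \ T, 2 * r < ‖f x - z₀‖ := fun x hx => by
    by_contra hcon
    refine hx.2 (self_subset_cthickening C ⟨hx.1, ?_⟩)
    simpa [dist_eq_norm] using hcon
  have hfar : ∀ {y : EuclideanSpace ℝ (Fin n)} {c : ℝ}, 0 ≤ c → c ≤ 1 → 2 * r ≤ ‖y - z₀‖ →
      ε < ‖y - c • (z - z₀) - z₀‖ := fun {y c} hc0 hc1 hy => by
    have e : y - c • (z - z₀) - z₀ = (y - z₀) - c • (z - z₀) := by abel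
    have h1 := norm_sub_norm_le (y - z₀) (c • (z - z₀))
    rw [norm_smul, Real.norm_of_nonneg hc0] at h1
    have h2 : c * ‖z - z₀‖ ≤ 1 * ‖z - z₀‖ := by gcongr
    rw [e]
    linarith
  have hfar1 : ∀ {y : EuclideanSpace ℝ (Fin n)}, 2 * r ≤ ‖y - z₀‖ → ε < ‖y - z‖ := fun {y} hy => by
    have := hfar zero_le_one le_rfl hy
    rwa [one_smul, sub_sub, sub_add_cancel] at this
  rw [degreeVolume, degreeVolume,
    hTA fun x hx => det_fderiv_clamp_eq_zero hf.continuous hε (hfar1 (hout x hx).le),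
    hTA fun x hx => det_fderiv_clamp_eq_zero hf.continuous hε (by linarith [hout x hx])]
  have hLc : ∀ {K} {u : EuclideanSpace ℝ (Fin n) → EuclideanSpace ℝ (Fin n)}
      (_ : LipschitzWith K u), LipschitzWith (2 * (K + 0)) fun x => clamp ε (u x - z₀) :=
    fun {K u} hu => (lipschitzWith_clamp hε).comp (hu.sub (LipschitzWith.const z₀))
  rw [setIntegral_det_fderiv_congr (hLc hf) (hLc hhL) hTc.measurableSet hTc.measure_lt_top
    fun x hx => by simp [h, hχ0 x hx]]
  refine setIntegral_congr_fun hTc.measurableSet fun x hx => ?_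
  rcases lt_or_ge ‖f x - z₀‖ (2 * r) with hlt | hge
  · congr 1
    refine Filter.EventuallyEq.fderiv_eq ?_
    have h1 : ∀ᶠ x' in nhds x, ‖f x' - z₀‖ < 2 * r :=
      (hf.continuous.sub continuous_const).norm.continuousAt.eventually (gt_mem_nhds hlt)
    filter_upwards [h1, hA.mem_nhds (hδA hx)] with x' h1 h2
    have : χ x' = 1 := hχ1 x' ⟨h2, by simpa [dist_eq_norm] using h1.le⟩
    simp only [h, this, one_smul, sub_sub, sub_add_cancel]
  · rw [det_fderiv_clamp_eq_zero hf.continuous hε (hfar1 hge),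
      det_fderiv_clamp_eq_zero hhL.continuous hε (hfar (hχnn x) (hχle x) hge)]

lemma degreeVolume_eq_zero (hf : Continuous f) (hε : 0 < ε) {z : EuclideanSpace ℝ (Fin n)}
    (h : ∀ x ∈ A, ε < ‖f x - z‖) : degreeVolume f A ε z = 0 :=
  setIntegral_eq_zero_of_forall_eq_zero fun x hx => det_fderiv_clamp_eq_zero hf hε (h x hx)

lemma lt_norm_sub_of_eq_id (hR : MapsTo f (closedBall 0 R) (closedBall 0 R))
    (hid : ∀ x, R ≤ ‖x‖ → f x = x) {x z : EuclideanSpace ℝ (Fin n)} (hz : R + ε < ‖z‖)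
    (hx : ε < ‖x - z‖) : ε < ‖f x - z‖ := by
  rcases le_total R ‖x‖ with h | h
  · rwa [hid x h]
  · have h1 : ‖f x‖ ≤ R := by simpa using hR (show x ∈ closedBall 0 R by simpa using h)
    have h2 := norm_sub_norm_le z (f x)
    rw [norm_sub_rev] at h2
    linarith

lemma degreeVolume_eq_volume (hf : Continuous f) (hR : MapsTo f (closedBall 0 R) (closedBall 0 R))
    (hid : ∀ x, R ≤ ‖x‖ → f x = x) (hA : IsOpen A) (hε : 0 < ε) {z : EuclideanSpace ℝ (Fin n)}
    (hz : R + ε < ‖z‖) (hzA : closedBall z ε ⊆ A) :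
    degreeVolume f A ε z = (volume (ball z ε)).toReal := by
  have hae : (closedBall z ε : Set (EuclideanSpace ℝ (Fin n))) =ᵐ[volume] ball z ε := by
    rw [← ball_union_sphere]
    exact union_ae_eq_left_of_ae_eq_empty
      (ae_eq_empty.2 (Measure.addHaar_sphere_of_ne_zero volume z hε.ne'))
  rw [degreeVolume, setIntegral_eq_of_subset_of_forall_sdiff_eq_zero hA.measurableSet hzA
    fun x hx => det_fderiv_clamp_eq_zero hf hε (lt_norm_sub_of_eq_id hR hid hz
      (by simpa [dist_eq_norm] using hx.2)), setIntegral_congr_set hae]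
  have h1 : ∀ x ∈ ball z ε, (fderiv ℝ (fun x => clamp ε (f x - z)) x).det = 1 := fun x hx => by
    have h2 : (fun x => clamp ε (f x - z)) =ᶠ[nhds x] fun x => x - z := by
      filter_upwards [isOpen_ball.mem_nhds hx] with x' hx'
      rw [mem_ball, dist_eq_norm] at hx'
      have h3 : R ≤ ‖x'‖ := by
        have := norm_sub_norm_le z x'
        rw [norm_sub_rev] at this
        linarith
      rw [hid x' h3, clamp_of_norm_le hε hx'.le]
    rw [h2.fderiv_eq, fderiv_sub_const, fderiv_fun_id]
    simp [ContinuousLinearMap.det]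
  rw [setIntegral_congr_fun measurableSet_ball h1]
  simp [Measure.real]

end degree

/-- The points off `f '' E` around which `f` has degree one on `A`. -/
def degreeOneRegion {n : ℕ} (f : EuclideanSpace ℝ (Fin n) → EuclideanSpace ℝ (Fin n))
    (A E : Set (EuclideanSpace ℝ (Fin n))) : Set (EuclideanSpace ℝ (Fin n)) :=
  {z | z ∉ f '' E ∧ ∀ᶠ ε in nhdsWithin (0 : ℝ) (Ioi 0),
    degreeVolume f A ε z = (volume (ball (0 : EuclideanSpace ℝ (Fin n)) ε)).toReal}

section region
variable {n d : ℕ} {f : EuclideanSpace ℝ (Fin n) → EuclideanSpace ℝ (Fin n)}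
  {A E : Set (EuclideanSpace ℝ (Fin n))} {R : ℝ} {K : ℝ≥0}

lemma isClosed_image_of_eq_id (hf : Continuous f) (hid : ∀ x, R ≤ ‖x‖ → f x = x)
    (hE : IsClosed E) : IsClosed (f '' E) := by
  have h : f '' E = f '' (E ∩ closedBall 0 R) ∪ E ∩ {x | R ≤ ‖x‖} := by
    ext y
    constructor
    · rintro ⟨x, hx, rfl⟩
      rcases le_total R ‖x‖ with h | h
      · right; rw [hid x h]; exact ⟨hx, h⟩
      · left; exact ⟨x, ⟨hx, by simpa using h⟩, rfl⟩
    · rintro (⟨x, hx, rfl⟩ | ⟨hy, h⟩)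
      · exact ⟨x, hx.1, rfl⟩
      · exact ⟨y, hy, hid y h⟩
  rw [h]
  exact (((isCompact_closedBall 0 R).inter_left hE).image hf).isClosed.union
    (hE.inter (isClosed_le continuous_const continuous_norm))

lemma eventually_mem_degreeOneRegion_iff (hf : LipschitzWith K f)
    (hid : ∀ x, R ≤ ‖x‖ → f x = x) (hA : IsOpen A) (hE : IsClosed E) (hAE : IsClosed (A ∪ E))
    {z : EuclideanSpace ℝ (Fin n)} (hz : z ∉ f '' E) :
    ∀ᶠ z' in nhds z, (z' ∈ degreeOneRegion f A E ↔ z ∈ degreeOneRegion f A E) := by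
  have hF := isClosed_image_of_eq_id hf.continuous hid hE
  obtain ⟨r, hr, hrF⟩ := Metric.isOpen_iff.1 hF.isOpen_compl z hz
  have hE' : ∀ x ∈ E, 2 * (r / 4) < ‖f x - z‖ := fun x hx => by
    by_contra hcon
    refine hrF (a := f x) ?_ ⟨x, hx, rfl⟩
    rw [mem_ball, dist_eq_norm]
    linarith
  filter_upwards [ball_mem_nhds z (by positivity : 0 < r / 4)] with z' hz'
  have hz'F : z' ∉ f '' E := hrF (ball_subset_ball (by linarith) hz')
  rw [mem_ball, dist_eq_norm] at hz'
  simp only [degreeOneRegion, mem_ofPred_eq, hz, hz'F, not_false_eq_true, true_and]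
  refine Filter.eventually_congr ?_
  filter_upwards [Ioo_mem_nhdsGT (by positivity : 0 < r / 4)] with ε hε
  rw [degreeVolume_eq hf hid hA hAE hE' hε.1 hε.2 hz']

lemma mem_degreeOneRegion_of_mem (hf : Continuous f)
    (hR : MapsTo f (closedBall 0 R) (closedBall 0 R)) (hid : ∀ x, R ≤ ‖x‖ → f x = x)
    (hA : IsOpen A) (hAE : Disjoint A E) {z : EuclideanSpace ℝ (Fin n)} (hz : R < ‖z‖)
    (hzA : z ∈ A) : z ∈ degreeOneRegion f A E := by
  constructor
  · rintro ⟨x, hx, rfl⟩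
    have hx' : R ≤ ‖x‖ := by
      by_contra hcon
      have := hR (show x ∈ closedBall 0 R by simpa using (not_le.1 hcon).le)
      rw [mem_closedBall, dist_zero_right] at this
      linarith
    rw [hid x hx'] at hzA
    exact disjoint_left.1 hAE hzA hx
  · obtain ⟨r, hr, hrA⟩ := Metric.isOpen_iff.1 hA z hzA
    filter_upwards [Ioo_mem_nhdsGT hr, Ioo_mem_nhdsGT (sub_pos.2 hz)] with ε hε hε'
    rw [degreeVolume_eq_volume hf hR hid hA hε.1 (by linarith [hε'.2])
      ((closedBall_subset_ball hε.2).trans hrA), Measure.addHaar_ball_center]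

lemma mem_of_mem_degreeOneRegion (hf : Continuous f)
    (hR : MapsTo f (closedBall 0 R) (closedBall 0 R)) (hid : ∀ x, R ≤ ‖x‖ → f x = x)
    (hAE : IsClosed (A ∪ E)) {z : EuclideanSpace ℝ (Fin n)} (hz : R < ‖z‖)
    (hzΩ : z ∈ degreeOneRegion f A E) : z ∈ A := by
  by_contra hzA
  have hzE : z ∉ E := fun h => hzΩ.1 ⟨z, h, hid z hz.le⟩
  obtain ⟨r, hr, hrA⟩ := Metric.isOpen_iff.1 hAE.isOpen_compl z (by simp [hzA, hzE])
  obtain ⟨ε, h, hε, hε'⟩ := (hzΩ.2.and ((Filter.Eventually.and (Ioo_mem_nhdsGT hr)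
    (Ioo_mem_nhdsGT (sub_pos.2 hz))))).exists
  rw [degreeVolume_eq_zero hf hε.1 fun x hx => lt_norm_sub_of_eq_id hR hid
    (by linarith [hε'.2] : R + ε < ‖z‖) ?_] at h
  · exact (ENNReal.toReal_pos (measure_ball_pos volume 0 hε.1).ne' measure_ball_lt_top.ne).ne h
  · by_contra hcon
    refine hrA (a := x) ?_ (Or.inl hx)
    rw [mem_ball, dist_eq_norm]
    linarith [hε.2]

lemma separatedBy_degreeOneRegion (hf : LipschitzWith K f)
    (hid : ∀ x, R ≤ ‖x‖ → f x = x) (hA : IsOpen A) (hE : IsClosed E) (hAE : IsClosed (A ∪ E))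
    (hEfin : ∀ r, μHE[d] (E ∩ closedBall 0 r) < ⊤) :
    SeparatedBy d (degreeOneRegion f A E) (f '' E) where
  isClosed := isClosed_image_of_eq_id hf.continuous hid hE
  measurableSet := by
    refine IsOpen.measurableSet (isOpen_iff_mem_nhds.2 fun z hz => ?_)
    filter_upwards [eventually_mem_degreeOneRegion_iff hf hid hA hE hAE hz.1] with z' h
    exact h.2 hz
  eventually_mem_iff z hz := eventually_mem_degreeOneRegion_iff hf hid hA hE hAE hz
  measure_lt_top r := by
    have h : f '' E ∩ closedBall 0 r ⊆ f '' (E ∩ closedBall 0 R) ∪ E ∩ closedBall 0 r := by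
      rintro _ ⟨⟨x, hx, rfl⟩, hr⟩
      rcases le_total R ‖x‖ with h | h
      · right; rw [hid x h] at hr ⊢; exact ⟨hx, hr⟩
      · left; exact ⟨x, ⟨hx, by simpa using h⟩, rfl⟩
    refine ((measure_mono h).trans (measure_union_le _ _)).trans_lt
      (ENNReal.add_lt_top.2 ⟨?_, hEfin r⟩)
    exact (euclideanHausdorffMeasure_image_le_of_lipschitzOnWith hf.lipschitzOnWith d).trans_lt
      (ENNReal.mul_lt_top (by finiteness) (hEfin R))

end region

lemma exists_euclideanHausdorffMeasure_eq_mul {X : Type*} [MetricSpace X] [MeasurableSpace X]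
    [BorelSpace X] (d : ℕ) :
    ∃ c : ℝ≥0, c ≠ 0 ∧ ∀ s : Set X, μHE[d] s = c * μH[(d : ℝ)] s :=
  ⟨_, Measure.addHaarScalarFactor_volume_hausdorffMeasure_ne_zero d, fun s => by
    rw [Measure.euclideanHausdorffMeasure_def, Measure.smul_apply, ENNReal.smul_def, smul_eq_mul]⟩

section minimality
variable {m : ℕ}

lemma setIntegral_divergence_le_of_eq_off_closedBall {δ R : ℝ} (hm : 4 ≤ m) (hδ : 0 < δ)
    {θ : EuclideanSpace ℝ (Fin (2 * m)) → ℝ} (hθ : ContDiff ℝ 1 θ) (hc : HasCompactSupport θ)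
    (hθ1 : ∀ z, ‖z‖ < R + 1 → θ z = 1) {Ω : Set (EuclideanSpace ℝ (Fin (2 * m)))}
    (hΩ : MeasurableSet Ω) (h : ∀ z, R < ‖z‖ → (z ∈ Ω ↔
      (inner ℝ z ((firstBlock m (2 * m) - lastBlock m (2 * m)) z) : ℝ) < 0)) :
    ∫ z in {z | (inner ℝ z ((firstBlock m (2 * m) - lastBlock m (2 * m)) z) : ℝ) < 0},
        divergence (fun z => θ z • calibration m δ z) z ≤
      ∫ z in Ω, divergence (fun z => θ z • calibration m δ z) z := by
  have hA : MeasurableSet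
      {z | (inner ℝ z ((firstBlock m (2 * m) - lastBlock m (2 * m)) z) : ℝ) < 0} :=
    (isOpen_lt (continuous_id.inner (ContinuousLinearMap.continuous _))
      continuous_const).measurableSet
  have hint := integrable_divergence_smul hθ hc (contDiff_calibration (m := m) hδ)
  have hdiv : ∀ z, ‖z‖ ≤ R → divergence (fun z => θ z • calibration m δ z) z =
      divergence (calibration m δ) z := fun z hz => by
    have h1 : (fun z => θ z • calibration m δ z) =ᶠ[nhds z] calibration m δ := by
      filter_upwards [(isOpen_lt continuous_norm continuous_const).mem_nhds
        (show ‖z‖ < R + 1 by linarith)] with z' hz'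
      rw [hθ1 z' hz', one_smul]
    rw [divergence, h1.fderiv_eq, divergence]
  rw [← integral_indicator hA, ← integral_indicator hΩ]
  refine integral_mono (hint.indicator hA) (hint.indicator hΩ) fun z => ?_
  by_cases h1 : (inner ℝ z ((firstBlock m (2 * m) - lastBlock m (2 * m)) z) : ℝ) < 0 <;>
    by_cases h2 : z ∈ Ω
  · simp only [indicator, mem_ofPred_eq, if_pos h1, if_pos h2, le_refl]
  · have hz : ‖z‖ ≤ R := not_lt.1 fun hz => h2 ((h z hz).2 h1)
    simp only [indicator, mem_ofPred_eq, if_pos h1, if_neg h2, hdiv z hz]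
    exact divergence_calibration_nonpos hm hδ h1.le
  · have hz : ‖z‖ ≤ R := not_lt.1 fun hz => h1 ((h z hz).1 h2)
    simp only [indicator, mem_ofPred_eq, if_neg h1, if_pos h2, hdiv z hz]
    exact divergence_calibration_nonneg hm hδ (not_lt.1 h1)
  · simp only [indicator, mem_ofPred_eq, if_neg h1, if_neg h2, le_refl]

lemma euclideanHausdorffMeasure_cone_sdiff_le {d : ℕ} (hd : 2 * m = d + 1) (hm : 4 ≤ m)
    {f : EuclideanSpace ℝ (Fin (2 * m)) → EuclideanSpace ℝ (Fin (2 * m))} {K : ℝ≥0} {R : ℝ}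
    (hR0 : 0 ≤ R) (hf : LipschitzWith K f) (hR : MapsTo f (closedBall 0 R) (closedBall 0 R))
    (hid : ∀ x, R ≤ ‖x‖ → f x = x) {E : Set (EuclideanSpace ℝ (Fin (2 * m)))}
    (hE : E = {z | (inner ℝ z ((firstBlock m (2 * m) - lastBlock m (2 * m)) z) : ℝ) = 0}) :
    μHE[d] (E \ f '' E) ≤ μHE[d] (f '' E \ E) := by
  have hM := isSymmInvolution_blocks (m := m) (n := 2 * m)
  set M := firstBlock m (2 * m) - lastBlock m (2 * m)
  set A : Set (EuclideanSpace ℝ (Fin (2 * m))) := {z | (inner ℝ z (M z) : ℝ) < 0} with hA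
  set F := f '' E
  have hcont : Continuous fun z => (inner ℝ z (M z) : ℝ) := continuous_id.inner M.continuous
  have hAo : IsOpen A := isOpen_lt hcont continuous_const
  have hEsep : SeparatedBy d A E := hE ▸ hM.separatedBy hd
  have hAE : IsClosed (A ∪ E) := by
    have : A ∪ E = {z | (inner ℝ z (M z) : ℝ) ≤ 0} := by
      ext z; simp only [hA, hE, mem_union, mem_ofPred_eq, le_iff_lt_or_eq]
    rw [this]; exact isClosed_le hcont continuous_const
  have hdisj : Disjoint A E := by
    rw [disjoint_left]
    intro z hz hz'
    rw [hE] at hz'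
    exact (ne_of_lt (show (inner ℝ z (M z) : ℝ) < 0 from hz)) hz'
  have hFsep : SeparatedBy d (degreeOneRegion f A E) F :=
    separatedBy_degreeOneRegion hf hid hAo hEsep.isClosed hAE hEsep.measure_lt_top
  have hEfin := hEsep.isFiniteMeasureOnCompacts
  have hFfin := hFsep.isFiniteMeasureOnCompacts
  let b : ContDiffBump (0 : EuclideanSpace ℝ (Fin (2 * m))) :=
    ⟨R + 1, R + 2, by linarith, by linarith⟩
  have hb : ContDiff ℝ 1 b := b.contDiff
  have hbc : HasCompactSupport b := b.hasCompactSupport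
  have hb1 : ∀ z, ‖z‖ < R + 1 → b z = 1 := fun z hz =>
    b.one_of_mem_closedBall (by simpa using hz.le)
  have hbE : Integrable b ((μHE[d] : Measure _).restrict E) :=
    hb.continuous.integrable_of_hasCompactSupport hbc
  have hbF : Integrable b ((μHE[d] : Measure _).restrict F) :=
    hb.continuous.integrable_of_hasCompactSupport hbc
  have hk : ∀ k : ℕ, ∫ z in E, b z * ‖calibration m (1 / ((k : ℝ) + 1)) z‖ ∂μHE[d] ≤
      ∫ z in F, b z ∂μHE[d] := fun k => by
    have hδ : 0 < 1 / ((k : ℝ) + 1) := by positivity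
    have hξ := contDiff_calibration (m := m) hδ
    have h1 := hM.setIntegral_norm_le_flux hd hξ norm_smul_calibration calibration_zero hb hbc
      fun z => b.nonneg
    have h2 := setIntegral_divergence_le_of_eq_off_closedBall hm hδ hb hbc hb1 hFsep.measurableSet
      fun z hz => ⟨mem_of_mem_degreeOneRegion hf.continuous hR hid hAE hz,
        mem_degreeOneRegion_of_mem hf.continuous hR hid hAo hdisj hz⟩
    have h3 := hFsep.flux_le hd hb hbc (fun z => b.nonneg) hξ
    have h4 : ∫ z in F, b z * ‖calibration m (1 / ((k : ℝ) + 1)) z‖ ∂μHE[d] ≤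
        ∫ z in F, b z ∂μHE[d] := by
      refine integral_mono ?_ hbF fun z => mul_le_of_le_one_right b.nonneg
        (norm_calibration_le_one hδ z)
      exact (hb.continuous.mul hξ.continuous.norm).integrable_of_hasCompactSupport hbc.mul_right
    rw [hE]
    exact ((h1.trans h2).trans h3).trans h4
  have hlim : Filter.Tendsto
      (fun k : ℕ => ∫ z in E, b z * ‖calibration m (1 / ((k : ℝ) + 1)) z‖ ∂μHE[d])
      Filter.atTop (nhds (∫ z in E, b z ∂μHE[d])) := by
    refine tendsto_integral_of_dominated_convergence b (fun k => ?_) hbE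
      (fun k => Filter.Eventually.of_forall fun z => ?_) ?_
    · exact (hb.continuous.mul (contDiff_calibration (m := m)
        (by positivity)).continuous.norm).aestronglyMeasurable
    · rw [Real.norm_of_nonneg (mul_nonneg b.nonneg (norm_nonneg _))]
      exact mul_le_of_le_one_right b.nonneg (norm_calibration_le_one (by positivity) z)
    · have h0 : μHE[d] ({0} : Set (EuclideanSpace ℝ (Fin (2 * m)))) = 0 := by
        obtain ⟨c, -, hc⟩ :=
          exists_euclideanHausdorffMeasure_eq_mul (X := EuclideanSpace ℝ (Fin (2 * m))) d
        have := Measure.nullSingletonClass_hausdorff (EuclideanSpace ℝ (Fin (2 * m))) (d := (d : ℝ))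
          (by exact_mod_cast (by omega : 0 < d))
        rw [hc, measure_singleton, mul_zero]
      have h1 : ∀ᵐ z ∂((μHE[d] : Measure (EuclideanSpace ℝ (Fin (2 * m)))).restrict E), z ≠ 0 :=
        ae_restrict_of_ae (by simpa [ae_iff] using h0)
      filter_upwards [h1] with z hz
      simpa using (tendsto_norm_calibration hz).const_mul (b z)
  have hle : ∫ z in E, b z ∂μHE[d] ≤ ∫ z in F, b z ∂μHE[d] := le_of_tendsto' hlim hk
  have hEm := hEsep.isClosed.measurableSet
  have hFm := hFsep.isClosed.measurableSet
  have hEF : ∀ z ∈ E \ F, ‖z‖ ≤ R := fun z hz => by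
    by_contra hcon
    exact hz.2 ⟨z, hz.1, hid z (not_le.1 hcon).le⟩
  have hFE : ∀ z ∈ F \ E, ‖z‖ ≤ R := by
    rintro _ ⟨⟨x, hx, rfl⟩, hx'⟩
    rcases le_total R ‖x‖ with h | h
    · rw [hid x h] at hx'; exact absurd hx hx'
    · simpa using hR (show x ∈ closedBall 0 R by simpa using h)
  rw [← integral_inter_add_sdiff hFm hbE, ← integral_inter_add_sdiff hEm hbF, inter_comm F E,
    add_le_add_iff_left,
    setIntegral_congr_fun (hEm.diff hFm) fun z hz => hb1 z (by linarith [hEF z hz]),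
    setIntegral_congr_fun (hFm.diff hEm) fun z hz => hb1 z (by linarith [hFE z hz])] at hle
  have hEF' : μHE[d] (E \ F) < ⊤ := (measure_mono
    (show E \ F ⊆ E ∩ closedBall 0 R from fun z hz => ⟨hz.1, by simpa using hEF z hz⟩)).trans_lt (hEsep.measure_lt_top R)
  have hFE' : μHE[d] (F \ E) < ⊤ := (measure_mono
    (show F \ E ⊆ F ∩ closedBall 0 R from fun z hz => ⟨hz.1, by simpa using hFE z hz⟩)).trans_lt (hFsep.measure_lt_top R)
  rw [← ENNReal.toReal_le_toReal hEF'.ne hFE'.ne]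
  simpa [Measure.real] using hle

lemma setOf_sumSq_eq : {z : EuclideanSpace ℝ (Fin (2 * m)) | sumSq z 0 m = sumSq z m (2 * m)} =
    {z | (inner ℝ z ((firstBlock m (2 * m) - lastBlock m (2 * m)) z) : ℝ) = 0} := by
  ext z
  have h1 : sumSq z 0 m = ‖firstBlock m (2 * m) z‖ ^ 2 := by
    rw [EuclideanSpace.real_norm_sq_eq]
    refine Finset.sum_congr rfl fun i _ => ?_
    by_cases h : (i : ℕ) < m <;> simp [h]
  have h2 : sumSq z m (2 * m) = ‖lastBlock m (2 * m) z‖ ^ 2 := by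
    rw [EuclideanSpace.real_norm_sq_eq]
    refine Finset.sum_congr rfl fun i _ => ?_
    by_cases h : (i : ℕ) < m
    · simp [h, not_le.2 h]
    · simp [h, not_lt.1 h, i.2]
  rw [mem_ofPred_eq, mem_ofPred_eq, inner_blocks, h1, h2, sub_eq_zero]

end minimality

lemma IsDeformation.exists_eq_id_of_le_norm {n : ℕ}
    {φ : ℝ → EuclideanSpace ℝ (Fin n) → EuclideanSpace ℝ (Fin n)} (h : IsDeformation univ φ) :
    ∃ R, 0 ≤ R ∧ MapsTo (φ 1) (closedBall 0 R) (closedBall 0 R) ∧ ∀ x, R ≤ ‖x‖ → φ 1 x = x := by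
  obtain ⟨-, -, -, -, -, hc⟩ := h
  obtain ⟨r, hr⟩ := hc.isBounded.exists_norm_le
  have hmem : ∀ x, φ 1 x ≠ x → ‖x‖ ≤ r ∧ ‖φ 1 x‖ ≤ r := fun x hx => by
    have hx' : x ∈ {x ∈ closure univ | φ 1 x ≠ x} := ⟨by simp, hx⟩
    have h1 : (1 : ℝ) ∈ Icc (0 : ℝ) 1 := by simp
    exact ⟨hr _ (subset_closure (mem_biUnion h1 (Or.inl hx'))),
      hr _ (subset_closure (mem_biUnion h1 (Or.inr ⟨x, hx', rfl⟩)))⟩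
  refine ⟨max r 0 + 1, by positivity, fun x hx => ?_, fun x hx => ?_⟩
  · by_cases hx' : φ 1 x = x
    · rwa [hx']
    · have := (hmem x hx').2
      have := le_max_left r 0
      simp only [mem_closedBall, dist_zero_right]
      linarith
  · by_contra hx'
    have := (hmem x hx').1
    have := le_max_left r 0
    linarith

noncomputable section

/-- For every integer m ≥ 4, the generalized Simons cone
`S_m = {(x,y) ∈ ℝ^m × ℝ^m : |x| = |y|}` (written in ℝ^{2m}, with coordinate blocks
`[0,m)` and `[m,2m)`) is an Almgren minimal set of dimension 2m−1 in ℝ^{2m}. -/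
theorem simons_cone_almgren_minimal (m : ℕ) (hm : 4 ≤ m) :
    AlmgrenMinimal ((2*m - 1 : ℕ) : ℝ) (Set.univ)
      {z : EuclideanSpace ℝ (Fin (2*m)) | sumSq z 0 m = sumSq z m (2*m)} := by
  have hd : 2 * m = (2 * m - 1) + 1 := by omega
  have hsep := isSymmInvolution_blocks.separatedBy (M := firstBlock m (2 * m) - lastBlock m (2 * m)) hd
  obtain ⟨c, hc0, hc⟩ :=
    exists_euclideanHausdorffMeasure_eq_mul (X := EuclideanSpace ℝ (Fin (2 * m))) (2 * m - 1)
  have hc0' : (c : ENNReal) ≠ 0 := by exact_mod_cast hc0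
  rw [setOf_sumSq_eq]
  refine ⟨hsep.isClosed, by simp, fun x r _ => ?_, fun φ hφ => ?_⟩
  · have h1 := (measure_mono (inter_subset_inter_right _
      (closedBall_subset_closedBall' (le_refl (r + dist x 0))))).trans_lt
      (hsep.measure_lt_top (r + dist x 0))
    rw [hc] at h1
    exact ENNReal.lt_top_of_mul_ne_top_right h1.ne hc0'
  · obtain ⟨R, hR0, hR, hid⟩ := hφ.exists_eq_id_of_le_norm
    obtain ⟨K, hK⟩ := hφ.2.2.2.1
    rw [closure_univ, lipschitzOnWith_univ] at hK
    have h := euclideanHausdorffMeasure_cone_sdiff_le hd hm hR0 hK hR hid rfl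
    rw [hc, hc] at h
    exact (ENNReal.mul_le_mul_iff_right hc0' ENNReal.coe_ne_top).1 h

end
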